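/- arXiv:1312.3857 — 3 statements merged into one kernel-verified Lean document; each statement's English description precedes it below -/
import Mathlib

section
/- Let C be a non group-theoretical hyperoctahedral category of partitions and let p ∈ C ∩ P(0,n). Then every block of p has even length. -/
/-!
Basic combinatorics of categories of partitions (Banica–Speicher easy quantum groups).

A partition with `k` upper and `l` lower points is encoded as an equivalence
relation (a `Setoid`) on the set `Fin k ⊕ Fin l` of its points; its blocks are
the equivalence classes.
-/

namespace EasyQG

/-- A partition of `k` upper and `l` lower points into blocks. -/
abbrev Partition (k l : ℕ) : Type := Setoid (Fin k ⊕ Fin l)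

/-- The relation "lying in the same block" of a partition. -/
def inSameBlock {k l : ℕ} (p : Partition k l) :
    (Fin k ⊕ Fin l) → (Fin k ⊕ Fin l) → Prop :=
  @Setoid.r _ p

/-- The partition in `P(0,n)` associated to a word: two points lie in the same
block iff they carry the same letter. -/
def ofWord {n : ℕ} (w : Fin n → ℕ) : Partition 0 n :=
  Setoid.ker (Sum.elim Fin.elim0 w)

/-- The partition in `P(0,n)` associated to a word given as a list of letters. -/
def ofList (w : List ℕ) : Partition 0 w.length :=
  ofWord w.get

/-- The identity partition `|` in `P(1,1)`: one upper point joined to one lower point. -/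
def idPartition : Partition 1 1 := ⊤

/-- The pair partition `⊓` in `P(0,2)`: two points in one block. -/
def pairPartition : Partition 0 2 := ⊤

/-- The double singleton `↓⊗↓` in `P(0,2)`: two points in two different blocks. -/
def doubleSingleton : Partition 0 2 := ⊥

/-- The four block partition `⊓⊓` in `P(0,4)`: four points in one block (word `aaaa`). -/
def fourBlock : Partition 0 4 := ⊤

/-- The fat crossing partition in `P(4,4)`, with blocks `{1,2,3',4'}` and `{3,4,1',2'}`. -/
def fatCross : Partition 4 4 :=
  Setoid.ker (Sum.elim (fun i => decide (i.val < 2)) (fun j => decide (2 ≤ j.val)))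

/-- The pair positioner partition in `P(3,3)`, with blocks `{1,2,2',3'}` and `{3,1'}`. -/
def pairPositioner : Partition 3 3 :=
  Setoid.ker (Sum.elim (fun i => decide (i.val < 2)) (fun j => decide (1 ≤ j.val)))

/-- The `s`-mixing partition `h_s ∈ P(0,2s)`, the word `abab…ab` of length `2s`. -/
def sMixing (s : ℕ) : Partition 0 (2 * s) := ofWord (fun i => i.val % 2)

/-- The partition `π_k ∈ P(0,4k)`, the word `a₁…a_k a_k…a₁ a₁…a_k a_k…a₁`
in `k` distinct letters. -/
def piPartition (k : ℕ) : Partition 0 (4 * k) :=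
  ofWord (fun i =>
    if i.val % (2 * k) < k then i.val % (2 * k) else 2 * k - 1 - i.val % (2 * k))

/-- The disjoint sum of two set partitions. -/
def sumSetoid {α β : Type*} (ra : Setoid α) (rb : Setoid β) : Setoid (α ⊕ β) where
  r := Sum.LiftRel (@Setoid.r _ ra) (@Setoid.r _ rb)
  iseqv := by
    constructor
    · intro x
      cases x with
      | inl a => exact Sum.LiftRel.inl (ra.iseqv.refl a)
      | inr b => exact Sum.LiftRel.inr (rb.iseqv.refl b)
    · intro x y h
      cases h with
      | inl h => exact Sum.LiftRel.inl (ra.iseqv.symm h)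
      | inr h => exact Sum.LiftRel.inr (rb.iseqv.symm h)
    · intro x y z h1 h2
      cases h1 with
      | inl h1 => cases h2 with
        | inl h2 => exact Sum.LiftRel.inl (ra.iseqv.trans h1 h2)
      | inr h1 => cases h2 with
        | inr h2 => exact Sum.LiftRel.inr (rb.iseqv.trans h1 h2)

/-- Tensor product (horizontal concatenation) of partitions. -/
def tensor {k l k' l' : ℕ} (p : Partition k l) (q : Partition k' l') :
    Partition (k + k') (l + l') :=
  Setoid.comap
    (fun x => (Equiv.sumSumSumComm (Fin k) (Fin k') (Fin l) (Fin l'))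
      (Sum.map finSumFinEquiv.symm finSumFinEquiv.symm x))
    (sumSetoid p q)

/-- Composition (vertical concatenation) of partitions `p ∈ P(k,l)` and `q ∈ P(l,m)`:
blocks are joined along the `l` middle points, which are then deleted. -/
def comp {k l m : ℕ} (p : Partition k l) (q : Partition l m) : Partition k m :=
  Setoid.comap (Sum.map id Sum.inr)
    (Relation.EqvGen.setoid (fun x y : Fin k ⊕ (Fin l ⊕ Fin m) =>
      (∃ a b, inSameBlock p a b ∧ Sum.map id Sum.inl a = x ∧ Sum.map id Sum.inl b = y) ∨
      (∃ a b, inSameBlock q a b ∧ Sum.inr a = x ∧ Sum.inr b = y)))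

/-- Involution (turning a partition upside down). -/
def involution {k l : ℕ} (p : Partition k l) : Partition l k :=
  Setoid.comap Sum.swap p

/-- Rotation moving the leftmost upper point to the left end of the lower row. -/
def rotUL {k l : ℕ} (p : Partition (k + 1) l) : Partition k (l + 1) :=
  Setoid.comap
    (Sum.elim (fun i => Sum.inl i.succ)
      (fun j => Fin.cases (Sum.inl (0 : Fin (k + 1))) (fun j' => Sum.inr j') j)) p

/-- Rotation moving the leftmost lower point to the left end of the upper row. -/
def rotLU {k l : ℕ} (p : Partition k (l + 1)) : Partition (k + 1) l :=
  Setoid.comap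
    (Sum.elim (fun i => Fin.cases (Sum.inr (0 : Fin (l + 1))) (fun i' => Sum.inl i') i)
      (fun j => Sum.inr j.succ)) p

/-- Rotation moving the rightmost upper point to the right end of the lower row. -/
def rotUR {k l : ℕ} (p : Partition (k + 1) l) : Partition k (l + 1) :=
  Setoid.comap
    (Sum.elim (fun i => Sum.inl i.castSucc)
      (fun j => Fin.lastCases (Sum.inl (Fin.last k)) (fun j' => Sum.inr j') j)) p

/-- Rotation moving the rightmost lower point to the right end of the upper row. -/
def rotRU {k l : ℕ} (p : Partition k (l + 1)) : Partition (k + 1) l :=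
  Setoid.comap
    (Sum.elim (fun i => Fin.lastCases (Sum.inr (Fin.last l)) (fun i' => Sum.inl i') i)
      (fun j => Sum.inr j.castSucc)) p

/-- A category of partitions: a collection of partitions containing the identity
partition and closed under the category operations (tensor product, composition,
involution and the four rotations). -/
structure PartitionCategory where
  mem : Set (Σ k l : ℕ, Partition k l)
  id_mem : ⟨1, 1, idPartition⟩ ∈ mem
  tensor_mem : ∀ {k l k' l' : ℕ} {p : Partition k l} {q : Partition k' l'},
    ⟨k, l, p⟩ ∈ mem → ⟨k', l', q⟩ ∈ mem → ⟨k + k', l + l', tensor p q⟩ ∈ mem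
  comp_mem : ∀ {k l m : ℕ} {p : Partition k l} {q : Partition l m},
    ⟨k, l, p⟩ ∈ mem → ⟨l, m, q⟩ ∈ mem → ⟨k, m, comp p q⟩ ∈ mem
  involution_mem : ∀ {k l : ℕ} {p : Partition k l},
    ⟨k, l, p⟩ ∈ mem → ⟨l, k, involution p⟩ ∈ mem
  rotUL_mem : ∀ {k l : ℕ} {p : Partition (k + 1) l},
    ⟨k + 1, l, p⟩ ∈ mem → ⟨k, l + 1, rotUL p⟩ ∈ mem
  rotLU_mem : ∀ {k l : ℕ} {p : Partition k (l + 1)},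
    ⟨k, l + 1, p⟩ ∈ mem → ⟨k + 1, l, rotLU p⟩ ∈ mem
  rotUR_mem : ∀ {k l : ℕ} {p : Partition (k + 1) l},
    ⟨k + 1, l, p⟩ ∈ mem → ⟨k, l + 1, rotUR p⟩ ∈ mem
  rotRU_mem : ∀ {k l : ℕ} {p : Partition k (l + 1)},
    ⟨k, l + 1, p⟩ ∈ mem → ⟨k + 1, l, rotRU p⟩ ∈ mem

/-- The members of the smallest category of partitions containing `S`
(the category `⟨S⟩` generated by `S`). -/
def generated (S : Set (Σ k l : ℕ, Partition k l)) : Set (Σ k l : ℕ, Partition k l) :=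
  {x | ∀ C : PartitionCategory, S ⊆ C.mem → x ∈ C.mem}

/-- A category of partitions is hyperoctahedral if it contains the four block
partition `⊓⊓` but not the double singleton `↓⊗↓`. -/
def Hyperoctahedral (C : PartitionCategory) : Prop :=
  (⟨0, 4, fourBlock⟩ : Σ k l : ℕ, Partition k l) ∈ C.mem ∧
    (⟨0, 2, doubleSingleton⟩ : Σ k l : ℕ, Partition k l) ∉ C.mem

/-- A category of partitions is group-theoretical if it contains the pair
positioner partition. -/
def GroupTheoretical (C : PartitionCategory) : Prop :=
  (⟨3, 3, pairPositioner⟩ : Σ k l : ℕ, Partition k l) ∈ C.mem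

/-- The generating set `{π_l | 1 ≤ l ≤ k}`. -/
def piUpTo (k : ℕ) : Set (Σ k l : ℕ, Partition k l) :=
  {x | ∃ l : ℕ, 1 ≤ l ∧ l ≤ k ∧ x = ⟨0, 4 * l, piPartition l⟩}

/-- The generating set `{π_l | l ∈ ℕ, l ≥ 1}`. -/
def piAll : Set (Σ k l : ℕ, Partition k l) :=
  {x | ∃ l : ℕ, 1 ≤ l ∧ x = ⟨0, 4 * l, piPartition l⟩}

end EasyQG
namespace EasyQG

/-- Merging the blocks of the points `x` and `y` of a partition. -/
def merge {k l : ℕ} (p : Partition k l) (x y : Fin k ⊕ Fin l) : Partition k l :=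
  Relation.EqvGen.setoid (fun u v => inSameBlock p u v ∨ (u = x ∧ v = y) ∨ (u = y ∧ v = x))

/-- The word `a_{i(1)}^{k(1)} … a_{i(m)}^{k(m)}` determined by a list of
letters with exponents. -/
def expand (blocks : List (ℕ × ℕ)) : List ℕ :=
  (blocks.map fun be => List.replicate be.2 be.1).flatten

/-- The run decomposition of a word: the list of its (letter, exponent) blocks. -/
def runs : List ℕ → List (ℕ × ℕ)
  | [] => []
  | a :: rest =>
    match runs rest with
    | [] => [(a, 1)]
    | (b, e) :: rs => if a = b then (b, e + 1) :: rs else (a, 1) :: (b, e) :: rs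

/-- The single-double leg form associated to a word: every odd exponent is
replaced by `1` and every even exponent by `2`. -/
def sdForm (w : List ℕ) : List ℕ :=
  expand ((runs w).map fun be => (be.1, if Odd be.2 then 1 else 2))

/-- A word is in single-double leg form if all its exponents are `1` or `2`. -/
def IsSingleDoubleLegForm (w : List ℕ) : Prop :=
  ∃ blocks : List (ℕ × ℕ), List.Chain' (fun x y => x.1 ≠ y.1) blocks ∧
    (∀ b ∈ blocks, b.2 = 1 ∨ b.2 = 2) ∧ w = expand blocks

/-- The vertical reflection of a partition: the left-to-right order of the
points is reversed in both rows, keeping the block structure. -/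
def verticalReflect {k l : ℕ} (p : Partition k l) : Partition k l :=
  Setoid.comap (Sum.map Fin.rev Fin.rev) p

/-- `leg [a₁,…,a_k] [X₁,…,X_{k-1}] = a₁ X₁ a₂ X₂ … a_{k-1} X_{k-1} a_k`:
a list of letters interleaved with filler words. -/
def leg : List ℕ → List (List ℕ) → List ℕ
  | [], _ => []
  | [a], _ => [a]
  | a :: rest, Xs => a :: (Xs.headD [] ++ leg rest Xs.tail)

/-- A word contains a W of depth `k` if it can be written as
`Y₁ S_α X_k^α S_β Y₂ S_γ X_k^γ S_δ Y₃`, where `S_α = a₁X₁^α a₂X₂^α…a_k`,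
`S_β = a_k X_{k-1}^β…X₁^β a₁`, `S_γ = a₁X₁^γ…a_k`, `S_δ = a_k X_{k-1}^δ…X₁^δ a₁`
for `k` distinct letters `a₁,…,a_k`, each of which occurs an odd number of
times in each of `S_α`, `S_β`, `S_γ`, `S_δ`. -/
def ContainsW (w : List ℕ) (k : ℕ) : Prop :=
  ∃ (as : List ℕ) (Xa Xb Xc Xd : List (List ℕ)) (Xka Xkc Y1 Y2 Y3 : List ℕ),
    as.length = k ∧ as.Nodup ∧
    Xa.length = k - 1 ∧ Xb.length = k - 1 ∧ Xc.length = k - 1 ∧ Xd.length = k - 1 ∧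
    w = Y1 ++ leg as Xa ++ Xka ++ leg as.reverse Xb ++ Y2 ++
        leg as Xc ++ Xkc ++ leg as.reverse Xd ++ Y3 ∧
    ∀ a ∈ as, Odd ((leg as Xa).count a) ∧ Odd ((leg as.reverse Xb).count a) ∧
      Odd ((leg as Xc).count a) ∧ Odd ((leg as.reverse Xd).count a)

/-- `wdepth w` is the maximal `k` such that some rotated version of the
word `w` contains a W of depth `k`. -/
noncomputable def wdepth (w : List ℕ) : ℕ :=
  sSup {k | ∃ r : ℕ, ContainsW (w.rotate r) k}

end EasyQG

namespace EasyQG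

/-- The category `C` contains the partition with upper word `u` and lower word `v`. -/
def WordMem (C : PartitionCategory) (u v : List ℕ) : Prop :=
  ∃ (k l : ℕ) (f : Fin k → ℕ) (g : Fin l → ℕ), List.ofFn f = u ∧ List.ofFn g = v ∧
    (⟨k, l, Setoid.ker (Sum.elim f g)⟩ : Σ k l : ℕ, Partition k l) ∈ C.mem

theorem wm_mk {C : PartitionCategory} {k l : ℕ} (p : Partition k l)
    (hp : (⟨k, l, p⟩ : Σ k l : ℕ, Partition k l) ∈ C.mem) (f : Fin k → ℕ) (g : Fin l → ℕ)
    (h : p = Setoid.ker (Sum.elim f g)) : WordMem C (List.ofFn f) (List.ofFn g) :=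
  ⟨k, l, f, g, rfl, rfl, h ▸ hp⟩

theorem wm_ofFn {C : PartitionCategory} {k l : ℕ} {f : Fin k → ℕ} {g : Fin l → ℕ}
    (h : WordMem C (List.ofFn f) (List.ofFn g)) :
    (⟨k, l, Setoid.ker (Sum.elim f g)⟩ : Σ k l : ℕ, Partition k l) ∈ C.mem := by
  obtain ⟨k', l', f', g', hf, hg, hm⟩ := h
  rw [List.ofFn_inj'] at hf hg
  cases hf
  cases hg
  exact hm

theorem wm_get {C : PartitionCategory} {u v : List ℕ} (h : WordMem C u v) :
    (⟨u.length, v.length, Setoid.ker (Sum.elim u.get v.get)⟩ : Σ k l : ℕ, Partition k l)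
      ∈ C.mem := by
  apply wm_ofFn
  simpa only [List.ofFn_get] using h

theorem wm_of_get {C : PartitionCategory} {u v : List ℕ}
    (p : Partition u.length v.length)
    (hp : (⟨u.length, v.length, p⟩ : Σ k l : ℕ, Partition k l) ∈ C.mem)
    (h : p = Setoid.ker (Sum.elim u.get v.get)) : WordMem C u v := by
  have := wm_mk p hp _ _ h
  simpa only [List.ofFn_get] using this

theorem wm_invol {C : PartitionCategory} {u v : List ℕ} (h : WordMem C u v) :
    WordMem C v u := by
  refine wm_of_get _ (C.involution_mem (wm_get h)) ?_
  ext x y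
  rcases x with x | x <;> rcases y with y | y <;> rfl

theorem wm_rotUL {C : PartitionCategory} {a : ℕ} {u v : List ℕ} (h : WordMem C (a :: u) v) :
    WordMem C u (a :: v) := by
  refine wm_of_get _ (C.rotUL_mem (k := u.length) (l := v.length) (wm_get h)) ?_
  have key : ∀ x : Fin u.length ⊕ Fin (v.length + 1),
      (Sum.elim (a :: u).get v.get)
      ((Sum.elim (fun i => Sum.inl i.succ)
        (fun j => Fin.cases (Sum.inl (0 : Fin (u.length + 1))) (fun j' => Sum.inr j') j)) x)
      = Sum.elim u.get (a :: v).get x := by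
    rintro (x | x)
    · rfl
    · refine Fin.cases ?_ (fun x => ?_) x <;> rfl
  ext x y
  change _ = _ ↔ _ = _
  rw [key, key]

theorem wm_rotLU {C : PartitionCategory} {a : ℕ} {u v : List ℕ} (h : WordMem C u (a :: v)) :
    WordMem C (a :: u) v := by
  refine wm_of_get _ (C.rotLU_mem (k := u.length) (l := v.length) (wm_get h)) ?_
  have key : ∀ x : Fin (u.length + 1) ⊕ Fin v.length,
      (Sum.elim u.get (a :: v).get)
      ((Sum.elim (fun i => Fin.cases (Sum.inr (0 : Fin (v.length + 1))) (fun i' => Sum.inl i') i)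
      (fun j => Sum.inr j.succ)) x)
      = Sum.elim (a :: u).get v.get x := by
    rintro (x | x)
    · refine Fin.cases ?_ (fun x => ?_) x <;> rfl
    · rfl
  ext x y
  change _ = _ ↔ _ = _
  rw [key, key]

theorem wm_rotUR {C : PartitionCategory} {a : ℕ} {v : List ℕ} (h : WordMem C [a] v) :
    WordMem C [] (v ++ [a]) := by
  have h1 := wm_mk _ (C.rotUR_mem (k := 0) (l := v.length) (wm_get h))
    Fin.elim0 (Fin.snoc (α := fun _ => ℕ) v.get a) ?_
  · have e : List.ofFn (Fin.snoc (α := fun _ => ℕ) v.get a) = v ++ [a] := by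
      rw [List.ofFn_succ']
      simp
    rw [e] at h1
    simpa using h1
  have key : ∀ x : Fin 0 ⊕ Fin (v.length + 1),
      (Sum.elim [a].get v.get)
      ((Sum.elim (fun i => Sum.inl i.castSucc)
      (fun j => Fin.lastCases (Sum.inl (Fin.last 0)) (fun j' => Sum.inr j') j)) x)
      = Sum.elim Fin.elim0 (Fin.snoc (α := fun _ => ℕ) v.get a) x := by
    rintro (x | x)
    · exact x.elim0
    · refine Fin.lastCases ?_ (fun x => ?_) x <;> simp
  ext x y
  change _ = _ ↔ _ = _
  rw [key, key]

theorem wm_cyc {C : PartitionCategory} {a : ℕ} {v : List ℕ} (h : WordMem C [] (a :: v)) :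
    WordMem C [] (v ++ [a]) := wm_rotUR (wm_rotLU h)

theorem wm_rot {C : PartitionCategory} (u : List ℕ) : ∀ {v : List ℕ},
    WordMem C [] (u ++ v) → WordMem C [] (v ++ u) := by
  induction u with
  | nil => intro v h; simpa using h
  | cons a u ih =>
    intro v h
    have h1 : WordMem C [] (u ++ (v ++ [a])) := by
      have := wm_cyc (a := a) (v := u ++ v) h
      simpa using this
    have := ih h1
    simpa using this

theorem wm_up {C : PartitionCategory} (u : List ℕ) : ∀ {t v : List ℕ},
    WordMem C t (u ++ v) → WordMem C (u.reverse ++ t) v := by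
  induction u with
  | nil => intro t v h; simpa using h
  | cons a u ih =>
    intro t v h
    have := ih (wm_rotLU (a := a) (v := u ++ v) h)
    simpa using this

theorem comp_le {k l m : ℕ} {p : Partition k l} {q : Partition l m} {α : Type}
    (F : Fin k → α) (G : Fin l → α) (H : Fin m → α)
    (hp : ∀ a b, inSameBlock p a b → Sum.elim F G a = Sum.elim F G b)
    (hq : ∀ a b, inSameBlock q a b → Sum.elim G H a = Sum.elim G H b) (x y)
    (h : inSameBlock (comp p q) x y) : Sum.elim F H x = Sum.elim F H y := by
  have key : ∀ x y : Fin k ⊕ (Fin l ⊕ Fin m), Relation.EqvGen (fun x y : Fin k ⊕ (Fin l ⊕ Fin m) =>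
      (∃ a b, inSameBlock p a b ∧ Sum.map id Sum.inl a = x ∧ Sum.map id Sum.inl b = y) ∨
      (∃ a b, inSameBlock q a b ∧ Sum.inr a = x ∧ Sum.inr b = y)) x y →
      Sum.elim F (Sum.elim G H) x = Sum.elim F (Sum.elim G H) y := by
    intro x y h
    induction h with
    | rel x y h =>
      rcases h with ⟨a, b, hab, rfl, rfl⟩ | ⟨a, b, hab, rfl, rfl⟩
      · have := hp a b hab
        rcases a with a | a <;> rcases b with b | b <;> simpa using this
      · have := hq a b hab
        rcases a with a | a <;> rcases b with b | b <;> simpa using this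
    | refl x => rfl
    | symm x y _ ih => exact ih.symm
    | trans x y z _ _ h1 h2 => exact h1.trans h2
  have := key _ _ h
  rcases x with x | x <;> rcases y with y | y <;> simpa using this

/-- Chains in the composition, with all intermediate points recorded. -/
def compFull {k l m : ℕ} (p : Partition k l) (q : Partition l m) :
    Fin k ⊕ (Fin l ⊕ Fin m) → Fin k ⊕ (Fin l ⊕ Fin m) → Prop :=
  Relation.EqvGen (fun x y : Fin k ⊕ (Fin l ⊕ Fin m) =>
      (∃ a b, inSameBlock p a b ∧ Sum.map id Sum.inl a = x ∧ Sum.map id Sum.inl b = y) ∨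
      (∃ a b, inSameBlock q a b ∧ Sum.inr a = x ∧ Sum.inr b = y))

theorem compFull_p {k l m : ℕ} {p : Partition k l} {q : Partition l m} {a b}
    (h : inSameBlock p a b) : compFull p q (Sum.map id Sum.inl a) (Sum.map id Sum.inl b) :=
  Relation.EqvGen.rel _ _ (Or.inl ⟨a, b, h, rfl, rfl⟩)

theorem compFull_q {k l m : ℕ} {p : Partition k l} {q : Partition l m} {a b}
    (h : inSameBlock q a b) : compFull p q (Sum.inr a) (Sum.inr b) :=
  Relation.EqvGen.rel _ _ (Or.inr ⟨a, b, h, rfl, rfl⟩)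

theorem comp_word {k l m : ℕ} (f : Fin k → ℕ) (g : Fin l → ℕ) (h : Fin m → ℕ)
    (hc : ∀ i j, f i = h j → ∃ t, g t = f i) :
    comp (Setoid.ker (Sum.elim f g)) (Setoid.ker (Sum.elim g h)) = Setoid.ker (Sum.elim f h) := by
  ext x y
  constructor
  · exact comp_le (p := Setoid.ker (Sum.elim f g)) (q := Setoid.ker (Sum.elim g h)) f g h
      (fun a b h => h) (fun a b h => h) x y
  · intro hxy
    change compFull _ _ _ _
    change Sum.elim f h x = Sum.elim f h y at hxy
    rcases x with x | x <;> rcases y with y | y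
    · exact compFull_p (a := Sum.inl x) (b := Sum.inl y) hxy
    · obtain ⟨t, ht⟩ := hc x y hxy
      exact Relation.EqvGen.trans _ _ _ (compFull_p (a := Sum.inl x) (b := Sum.inr t) ht.symm)
        (compFull_q (a := Sum.inl t) (b := Sum.inr y) (ht.trans hxy))
    · obtain ⟨t, ht⟩ := hc y x hxy.symm
      exact Relation.EqvGen.trans _ _ _
        (compFull_q (a := Sum.inr x) (b := Sum.inl t) (hxy.trans ht.symm))
        (compFull_p (a := Sum.inr t) (b := Sum.inl y) ht)
    · exact compFull_q (a := Sum.inr x) (b := Sum.inr y) hxy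

theorem wm_comp {C : PartitionCategory} {u v w : List ℕ} (h1 : WordMem C u v)
    (h2 : WordMem C v w) (hc : ∀ a ∈ u, a ∈ w → a ∈ v) : WordMem C u w := by
  refine wm_of_get _ (C.comp_mem (wm_get h1) (wm_get h2)) (comp_word _ _ _ ?_)
  intro i j hij
  have := hc (u.get i) (List.get_mem _ _) (by rw [hij]; exact List.get_mem _ _)
  exact List.get_of_mem this

theorem pair_mem (C : PartitionCategory) :
    (⟨0, 2, pairPartition⟩ : Σ k l : ℕ, Partition k l) ∈ C.mem := by
  have := C.rotUL_mem (k := 0) (l := 1) C.id_mem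
  have e : rotUL (k := 0) (l := 1) idPartition = pairPartition := by
    ext x y
    exact ⟨fun _ => trivial, fun _ => trivial⟩
  rwa [e] at this

theorem wm_cap {C : PartitionCategory} {x y : ℕ} {w : List ℕ} (h : WordMem C [] (x :: y :: w)) :
    WordMem C [] (w.map (fun c => if c = y then x else c)) := by
  have h1 := wm_get (wm_rotLU (wm_rotLU h))
  have h2 := C.comp_mem (pair_mem C) h1
  have h3 := wm_mk _ h2 Fin.elim0 (fun i => if w.get i = y then x else w.get i) ?_
  · have e : List.ofFn (fun i => if w.get i = y then x else w.get i)
        = w.map (fun c => if c = y then x else c) := by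
      rw [← List.ofFn_get (w.map (fun c => if c = y then x else c)), List.ofFn_inj']
      refine Sigma.ext (by simp) ?_
      apply Function.hfunext (by simp)
      intro a b hab
      have : a.val = b.val := by
        rw [Fin.heq_ext_iff (by simp)] at hab
        exact hab
      simp [this]
    rw [e] at h3
    simpa using h3
  · ext a b
    constructor
    · refine comp_le (p := pairPartition) Fin.elim0 (fun _ => x) _ ?_ ?_ a b
      · intro a b _
        rcases a with a | a
        · exact a.elim0
        rcases b with b | b
        · exact b.elim0
        rfl
      · intro a b hab
        change Sum.elim [y, x].get w.get a = Sum.elim [y, x].get w.get b at hab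
        have key : ∀ a, Sum.elim (fun _ : Fin 2 => x)
            (fun i => if w.get i = y then x else w.get i) a =
            (fun c => if c = y then x else c) (Sum.elim [y, x].get w.get a) := by
          rintro (a | a)
          · fin_cases a <;> simp
          · rfl
        exact (key a).trans ((congrArg (fun c => if c = y then x else c) hab).trans (key b).symm)
    · intro hab
      rcases a with a | a
      · exact a.elim0
      rcases b with b | b
      · exact b.elim0
      change (if w.get a = y then x else w.get a) = (if w.get b = y then x else w.get b) at hab
      change compFull _ _ (Sum.inr (Sum.inr a)) (Sum.inr (Sum.inr b))
      by_cases e : w.get a = w.get b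
      · exact compFull_q (a := Sum.inr a) (b := Sum.inr b) e
      · by_cases ha : w.get a = y
        · have hb : w.get b = x := by grind
          refine Relation.EqvGen.trans _ _ _
            (compFull_q (a := Sum.inr a) (b := Sum.inl (0 : Fin 2)) ha) ?_
          refine Relation.EqvGen.trans _ _ _
            (compFull_p (a := Sum.inr (0 : Fin 2)) (b := Sum.inr (1 : Fin 2)) trivial) ?_
          exact compFull_q (a := Sum.inl (1 : Fin 2)) (b := Sum.inr b) hb.symm
        · have hb : w.get b = y := by grind
          have ha : w.get a = x := by grind
          refine Relation.EqvGen.trans _ _ _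
            (compFull_q (a := Sum.inr a) (b := Sum.inl (1 : Fin 2)) ha) ?_
          refine Relation.EqvGen.trans _ _ _
            (compFull_p (a := Sum.inr (1 : Fin 2)) (b := Sum.inr (0 : Fin 2)) trivial) ?_
          exact compFull_q (a := Sum.inl (0 : Fin 2)) (b := Sum.inr b) hb.symm

/-- The alternating word `xyxy…` of length `n`. -/
def altWord : ℕ → ℕ → ℕ → List ℕ
  | _, _, 0 => []
  | x, y, n + 1 => x :: altWord y x n

theorem altWord_snoc (k : ℕ) : ∀ x y, altWord x y (2 * k + 1) ++ [y, x] = altWord x y (2 * k + 3) := by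
  induction k with
  | zero => intro x y; rfl
  | succ k ih =>
    intro x y
    have := ih x y
    change x :: y :: (altWord x y (2 * k + 1) ++ [y, x]) = x :: y :: altWord x y (2 * k + 3)
    rw [this]

theorem altWord_snoc' (k : ℕ) : ∀ x y, altWord x y (2 * k + 1) ++ [y] = altWord x y (2 * k + 2) := by
  induction k with
  | zero => intro x y; rfl
  | succ k ih =>
    intro x y
    have := ih x y
    change x :: y :: (altWord x y (2 * k + 1) ++ [y]) = x :: y :: altWord x y (2 * k + 2)
    rw [this]

theorem altWord_reverse (k : ℕ) (x y) :
    (altWord x y (2 * k + 1)).reverse = altWord x y (2 * k + 1) := by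
  induction k with
  | zero => rfl
  | succ k ih =>
    have h : (altWord x y (2 * k + 1) ++ [y, x]).reverse = x :: y :: altWord x y (2 * k + 1) := by
      simp [ih]
    rw [altWord_snoc] at h
    exact h

theorem altWord_count (n : ℕ) : ∀ {x y : ℕ}, x ≠ y →
    (altWord x y n).count x = (n + 1) / 2 ∧ (altWord x y n).count y = n / 2 := by
  induction n with
  | zero => intro x y _; simp [altWord]
  | succ n ih =>
    intro x y h
    have := ih h.symm
    simp only [altWord, List.count_cons]
    simp [h, this]
    omega

theorem eq_altWord {w : List ℕ} : ∀ {x y : ℕ}, w.head? = some x →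
    w.IsChain (fun p q => (p = x ∧ q = y) ∨ (p = y ∧ q = x)) → x ≠ y →
    w = altWord x y w.length := by
  induction w with
  | nil => intro x y h; simp at h
  | cons a t ih =>
    intro x y h hc hxy
    simp at h
    subst h
    cases t with
    | nil => rfl
    | cons b t =>
      rw [List.isChain_cons_cons] at hc
      obtain ⟨h1, h2⟩ := hc
      have hb : b = y := by grind
      subst hb
      have := ih (x := b) (y := a) rfl (h2.imp (by grind)) hxy.symm
      change a :: b :: t = a :: altWord b a (b :: t).length
      rw [← this]

/-- From an alternating word of even length at least four one obtains `aabbaa`. -/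
theorem wm_alt {C : PartitionCategory} (h4 : ∀ a, WordMem C [a, a, a] [a]) {a b : ℕ} (k : ℕ)
    (h : WordMem C [] (altWord a b (2 * k + 4))) : WordMem C [a, a, b] [b, a, a] := by
  have h1 : WordMem C [a, a, a] (altWord b a (2 * k + 3)) := by
    refine wm_comp (h4 a) (wm_rotLU h) ?_
    simp
  have h2 : WordMem C [] ([a, a] ++ (altWord a b (2 * (k + 1) + 1) ++ [b])) := by
    rw [altWord_snoc']
    exact wm_rotUL (wm_rotUL (wm_rotUL h1))
  have h3 := wm_rot _ h2
  have h5 : WordMem C [] ([b, a, a] ++ altWord a b (2 * (k + 1) + 1)) := by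
    have := wm_rot (altWord a b (2 * (k + 1) + 1)) (v := [b, a, a]) (by simpa using h3)
    exact this
  have h6 : WordMem C (altWord a b (2 * (k + 1) + 1)) [b, a, a] := by
    have := wm_up (altWord a b (2 * (k + 1) + 1)) (t := []) (v := [b, a, a]) (by simpa using h3)
    rw [altWord_reverse] at this
    simpa using this
  have h7 : WordMem C [a, a, b] (altWord a b (2 * (k + 1) + 1)) := wm_up [b, a, a] h5
  refine wm_comp h7 h6 ?_
  intro c hc _
  change c ∈ a :: b :: altWord a b (2 * k + 1)
  simp at hc
  rcases hc with rfl | rfl <;> simp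

theorem count_subst_ne {p q c : ℕ} (hp : c ≠ p) (hq : c ≠ q) (t : List ℕ) :
    (t.map (fun c => if c = q then p else c)).count c = t.count c := by
  induction t with
  | nil => rfl
  | cons b t ih => simp only [List.map_cons, List.count_cons, ih]; grind

theorem count_subst {p q : ℕ} (h : p ≠ q) (t : List ℕ) :
    (t.map (fun c => if c = q then p else c)).count p = t.count p + t.count q := by
  induction t with
  | nil => rfl
  | cons b t ih => simp only [List.map_cons, List.count_cons, ih]; grind

theorem wm_even {C : PartitionCategory} (h4 : ∀ a, WordMem C [a, a, a] [a])
    (hds : ∀ a b, a ≠ b → ¬ WordMem C [] [a, b])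
    (hgt : ∀ a b, a ≠ b → ¬ WordMem C [a, a, b] [b, a, a]) :
    ∀ (n : ℕ) (w : List ℕ), w.length = n → WordMem C [] w → ∀ a, Even (w.count a) := by
  intro n
  induction n using Nat.strong_induction_on with
  | _ n ih =>
  intro w hn hw a
  by_contra ha
  rw [Nat.not_even_iff_odd] at ha
  have R : ∀ u p q v, w = u ++ p :: q :: v →
      p ≠ q ∧ ∀ c, Odd (w.count c) ↔ c = p ∨ c = q := by
    intro u p q v e
    subst e
    have h1 := wm_cap (wm_rot u hw)
    have h2 := ih _ (by rw [← hn]; simp; omega) _ rfl h1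
    have hcount : ∀ c, (u ++ p :: q :: v).count c =
        (v ++ u).count c + (if q = c then 1 else 0) + (if p = c then 1 else 0) := by
      intro c
      simp [List.count_cons]
      omega
    have h2' : ∀ c, Even (((v ++ u).map (fun c => if c = q then p else c)).count c) := by
      simpa using h2
    have hother : ∀ c, c ≠ p → c ≠ q → Even ((u ++ p :: q :: v).count c) := by
      intro c hp hq
      have := h2' c
      rw [count_subst_ne hp hq] at this
      rw [hcount, if_neg (Ne.symm hq), if_neg (Ne.symm hp)]
      simpa using this
    have hpq : p ≠ q := by
      rintro rfl
      have h3 := h2' a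
      have e : (v ++ u).map (fun c => if c = p then p else c) = v ++ u := by
        conv_rhs => rw [← List.map_id (v ++ u)]
        apply List.map_congr_left
        intro c _
        simp; tauto
      rw [e] at h3
      rw [hcount] at ha
      split_ifs at ha <;> grind
    have hsum : Even ((v ++ u).count p + (v ++ u).count q) := by
      have := h2' p
      rwa [count_subst hpq] at this
    have ep : (u ++ p :: q :: v).count p = (v ++ u).count p + 1 := by
      rw [hcount]; simp [hpq.symm]
    have eq : (u ++ p :: q :: v).count q = (v ++ u).count q + 1 := by
      rw [hcount]; simp [hpq]
    have hapq : a = p ∨ a = q := by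
      by_contra hcon
      push Not at hcon
      have := hother a hcon.1 hcon.2
      grind
    refine ⟨hpq, fun c => ⟨?_, ?_⟩⟩
    · intro hc
      by_contra hcon
      push Not at hcon
      have := hother c hcon.1 hcon.2
      grind
    · rintro (rfl | rfl) <;> rcases hapq with rfl | rfl <;> grind
  match w, hw, ha, R with
  | [], _, ha, _ => simp at ha
  | [x], hw, ha, _ =>
    have e : WordMem C [] [x + 1] := by
      refine wm_of_get (v := [x + 1]) (Setoid.ker (Sum.elim [].get [x].get)) (wm_get hw) ?_
      ext s t
      rcases s with s | s
      · exact s.elim0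
      rcases t with t | t
      · exact t.elim0
      fin_cases s
      fin_cases t
      exact ⟨fun _ => rfl, fun _ => rfl⟩
    have h1 : WordMem C [x] [x + 1] := wm_comp (wm_rotLU hw) e (by simp)
    exact hds x (x + 1) (by simp) (wm_rotUL h1)
  | x :: y :: v, hw, ha, R =>
    obtain ⟨hxy, hodd⟩ := R [] x y v rfl
    have halt : x :: y :: v = altWord x y (x :: y :: v).length := by
      refine eq_altWord rfl ?_ hxy
      rw [List.isChain_iff_forall_rel_of_append_cons_cons]
      intro p q l1 l2 e
      obtain ⟨hpq, ho⟩ := R _ _ _ _ e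
      have h1 := (hodd p).1 ((ho p).2 (Or.inl rfl))
      have h2 := (hodd q).1 ((ho q).2 (Or.inr rfl))
      grind
    have hx := (hodd x).2 (Or.inl rfl)
    have hy := (hodd y).2 (Or.inr rfl)
    rw [halt] at hx hy
    generalize hN : (x :: y :: v).length = N at *
    rw [(altWord_count N hxy).1] at hx
    rw [(altWord_count N hxy).2] at hy
    rw [halt] at hw
    by_cases hN2 : N = 2
    · subst hN2
      exact hds x y hxy hw
    · have : ∃ k, N = 2 * k + 4 := by
        refine ⟨(N - 4) / 2, ?_⟩
        grind
      obtain ⟨k, rfl⟩ := this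
      exact hgt x y hxy (wm_alt h4 k hw)

theorem statement13 (C : PartitionCategory) (hH : Hyperoctahedral C)
    (hG : ¬ GroupTheoretical C) {n : ℕ} (p : Partition 0 n)
    (hp : (⟨0, n, p⟩ : Σ k l : ℕ, Partition k l) ∈ C.mem) :
    ∀ x : Fin 0 ⊕ Fin n, Even (Nat.card {y // inSameBlock p x y}) := by
  have h4 : ∀ a, WordMem C [a, a, a] [a] := by
    intro a
    have : WordMem C [] [a, a, a, a] := by
      refine wm_of_get fourBlock hH.1 ?_
      ext x y
      rcases x with x | x
      · exact x.elim0
      rcases y with y | y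
      · exact y.elim0
      refine ⟨fun _ => ?_, fun _ => trivial⟩
      change [a, a, a, a].get x = [a, a, a, a].get y
      fin_cases x <;> fin_cases y <;> rfl
    exact wm_rotLU (wm_rotLU (wm_rotLU this))
  have hds : ∀ a b, a ≠ b → ¬ WordMem C [] [a, b] := by
    intro a b hab h
    apply hH.2
    suffices e : doubleSingleton = Setoid.ker (Sum.elim [].get [a, b].get) by
      rw [e]
      exact wm_get h
    refine Setoid.ext ?_
    intro x y
    rcases x with x | x
    · exact x.elim0
    rcases y with y | y
    · exact y.elim0
    change Sum.inr x = Sum.inr y ↔ [a, b].get x = [a, b].get y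
    fin_cases x <;> fin_cases y <;> simp [hab, hab.symm]
  have hgt : ∀ a b, a ≠ b → ¬ WordMem C [a, a, b] [b, a, a] := by
    intro a b hab h
    apply hG
    suffices e : pairPositioner = Setoid.ker (Sum.elim [a, a, b].get [b, a, a].get) by
      unfold GroupTheoretical
      rw [e]
      exact wm_get h
    have key : ∀ x : Fin 3 ⊕ Fin 3, Sum.elim [a, a, b].get [b, a, a].get x =
        if (Sum.elim (fun i : Fin 3 => decide (i.val < 2)) (fun j : Fin 3 => decide (1 ≤ j.val)) x)
          then a else b := by
      rintro (x | x) <;> fin_cases x <;> simp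
    refine Setoid.ext ?_
    intro x y
    change Sum.elim _ _ x = Sum.elim _ _ y ↔
      Sum.elim [a, a, b].get [b, a, a].get x = Sum.elim [a, a, b].get [b, a, a].get y
    rw [key, key]
    grind
  obtain ⟨F, hF⟩ := Countable.exists_injective_nat (Quotient p)
  let g : Fin n → ℕ := fun i => F (Quotient.mk p (Sum.inr i))
  have hpg : p = Setoid.ker (Sum.elim Fin.elim0 g) := by
    refine Setoid.ext ?_
    intro x y
    rcases x with x | x
    · exact x.elim0
    rcases y with y | y
    · exact y.elim0
    change _ ↔ F _ = F _
    rw [hF.eq_iff, Quotient.eq]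
  have hw := wm_mk p hp _ _ hpg
  have hw' : WordMem C [] (List.ofFn g) := by simpa using hw
  have hev := wm_even h4 hds hgt _ _ rfl hw'
  intro x
  rcases x with x | x
  · exact x.elim0
  have hc := hev (g x)
  have e : Nat.card {y // inSameBlock p (Sum.inr x) y} = (List.ofFn g).count (g x) := by
    have e1 : (List.ofFn g).count (g x) = Fintype.card {i : Fin n // g i = g x} := by
      have := Fin.card_filter_univ_eq_vector_get_eq_count (g x) (List.Vector.ofFn g)
      simp only [List.Vector.get_ofFn, List.Vector.toList_ofFn] at this
      rw [← this, Fintype.card_subtype]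
    rw [e1, ← Nat.card_eq_fintype_card]
    refine (Nat.card_congr ?_).symm
    refine Equiv.subtypeEquiv (Equiv.emptySum (Fin 0) (Fin n)).symm ?_
    intro i
    change _ ↔ p (Sum.inr x) (Sum.inr i)
    rw [hpg]
    exact eq_comm
  rw [e]
  exact hc

end EasyQG
end

section
/- Let C be a non group-theoretical hyperoctahedral category of partitions. If C contains a partition p ∈ P(0,n) with wdepth(p) = k, then π_k ∈ C. -/
namespace EasyQG
/-- Membership of a two-row word in the category. -/
def Q (C : PartitionCategory) {α : Type} (U D : List α) : Prop :=
  (⟨U.length, D.length, Setoid.ker (Sum.elim U.get D.get)⟩ : Σ k l : ℕ, Partition k l) ∈ C.mem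

/-- Membership of a one-row word in the category. -/
def M (C : PartitionCategory) {α : Type} (D : List α) : Prop := Q C [] D

theorem Q_intro {C : PartitionCategory} {α : Type} {k l : ℕ} {p : Partition k l}
    (hp : (⟨k, l, p⟩ : Σ k l : ℕ, Partition k l) ∈ C.mem) (U D : List α)
    (hU : U.length = k) (hD : D.length = l)
    (h : ∀ x y : Fin k ⊕ Fin l, inSameBlock p x y ↔
      Sum.elim (fun i : Fin k => U.get (i.cast hU.symm)) (fun j : Fin l => D.get (j.cast hD.symm)) x =
      Sum.elim (fun i : Fin k => U.get (i.cast hU.symm)) (fun j : Fin l => D.get (j.cast hD.symm)) y) :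
    Q C U D := by
  subst hU hD
  have : p = Setoid.ker (Sum.elim U.get D.get) := by
    ext x y
    exact h x y
  rw [this] at hp
  exact hp

theorem Q_elim {C : PartitionCategory} {α : Type} {k l : ℕ} {p : Partition k l}
    (U D : List α) (hp : Q C U D)
    (hU : U.length = k) (hD : D.length = l)
    (h : ∀ x y : Fin k ⊕ Fin l, inSameBlock p x y ↔
      Sum.elim (fun i : Fin k => U.get (i.cast hU.symm)) (fun j : Fin l => D.get (j.cast hD.symm)) x =
      Sum.elim (fun i : Fin k => U.get (i.cast hU.symm)) (fun j : Fin l => D.get (j.cast hD.symm)) y) :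
    (⟨k, l, p⟩ : Σ k l : ℕ, Partition k l) ∈ C.mem := by
  subst hU hD
  have : p = Setoid.ker (Sum.elim U.get D.get) := by
    ext x y
    exact h x y
  rw [this]
  exact hp

variable {C : PartitionCategory} {α β : Type}

theorem Q_down {a : α} {U D : List α} (h : Q C (a :: U) D) : Q C U (a :: D) := by
  refine Q_intro (C.rotUL_mem h) U (a :: D) rfl rfl ?_
  have e : (Sum.elim (a :: U).get D.get) ∘
      (Sum.elim (fun i => Sum.inl i.succ)
      (fun j => Fin.cases (Sum.inl (0 : Fin (U.length + 1))) (fun j' => Sum.inr j') j)) =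
      Sum.elim U.get (a :: D).get := by
    funext x
    rcases x with i | j
    · rfl
    · refine Fin.cases ?_ (fun j => ?_) j <;> rfl
  intro x y
  have h1 := congrFun e x
  have h2 := congrFun e y
  exact ⟨fun t => (h1.symm.trans t).trans h2, fun t => (h1.trans t).trans h2.symm⟩

theorem Q_up {a : α} {U D : List α} (h : Q C U (a :: D)) : Q C (a :: U) D := by
  refine Q_intro (C.rotLU_mem h) (a :: U) D rfl rfl ?_
  have e : (Sum.elim U.get (a :: D).get) ∘
      (Sum.elim (fun i => Fin.cases (Sum.inr (0 : Fin (D.length + 1))) (fun i' => Sum.inl i') i)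
      (fun j => Sum.inr j.succ)) =
      Sum.elim (a :: U).get D.get := by
    funext x
    rcases x with i | j
    · refine Fin.cases ?_ (fun j => ?_) i <;> rfl
    · rfl
  intro x y
  have h1 := congrFun e x
  have h2 := congrFun e y
  exact ⟨fun t => (h1.symm.trans t).trans h2, fun t => (h1.trans t).trans h2.symm⟩

theorem Q_right {a : α} {D : List α} (h : Q C [a] D) : Q C [] (D ++ [a]) := by
  have h' : (⟨0 + 1, D.length, Setoid.ker (Sum.elim [a].get D.get)⟩ :
    Σ k l : ℕ, Partition k l) ∈ C.mem := h
  refine Q_intro (C.rotUR_mem h') [] (D ++ [a]) rfl (by simp) ?_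
  have e : (Sum.elim [a].get D.get) ∘
      (Sum.elim (fun i => Sum.inl i.castSucc)
      (fun j => Fin.lastCases (Sum.inl (Fin.last 0)) (fun j' => Sum.inr j') j)) =
      Sum.elim ([] : List α).get (fun j : Fin (D.length + 1) => (D ++ [a]).get (j.cast (by simp))) := by
    funext x
    rcases x with i | j
    · exact i.elim0
    · refine Fin.lastCases ?_ (fun j => ?_) j
      · simp
      · simp
  intro x y
  have h1 := congrFun e x
  have h2 := congrFun e y
  exact ⟨fun t => (h1.symm.trans t).trans h2, fun t => (h1.trans t).trans h2.symm⟩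

theorem Q_inv {U D : List α} (h : Q C U D) : Q C D U := by
  refine Q_intro (C.involution_mem h) D U rfl rfl ?_
  have e : (Sum.elim U.get D.get) ∘ Sum.swap = Sum.elim D.get U.get := by
    funext x
    rcases x with i | j <;> rfl
  intro x y
  have h1 := congrFun e x
  have h2 := congrFun e y
  exact ⟨fun t => (h1.symm.trans t).trans h2, fun t => (h1.trans t).trans h2.symm⟩

theorem Q_downs {V U D : List α} (h : Q C (V ++ U) D) : Q C U (V.reverse ++ D) := by
  induction V generalizing D with
  | nil => exact h
  | cons a V ih =>
    have := ih (Q_down h)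
    simpa using this

theorem Q_ups {V U D : List α} (h : Q C U (V ++ D)) : Q C (V.reverse ++ U) D := by
  induction V generalizing U with
  | nil => exact h
  | cons a V ih =>
    have := ih (Q_up h)
    simpa using this

theorem M_rot1 {a : α} {D : List α} (h : M C (a :: D)) : M C (D ++ [a]) := Q_right (Q_up h)

theorem M_rot {u v : List α} (h : M C (u ++ v)) : M C (v ++ u) := by
  induction u generalizing v with
  | nil => simpa using h
  | cons a u ih =>
    have : M C (u ++ v ++ [a]) := M_rot1 h
    rw [List.append_assoc] at this
    simpa using ih this

theorem M_rev {u : List α} (h : M C u) : M C u.reverse := by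
  have h1 : Q C (u ++ []) [] := by simpa using Q_inv h
  simpa [M] using Q_downs h1

theorem M_map {f : α → β} {u : List α} (h : M C u)
    (hf : ∀ x ∈ u, ∀ y ∈ u, f x = f y → x = y) : M C (u.map f) := by
  refine Q_intro h [] (u.map f) rfl (by simp) ?_
  intro x y
  rcases x with i | i
  · exact i.elim0
  rcases y with j | j
  · exact j.elim0
  show u.get i = u.get j ↔ _
  simp only [Sum.elim_inr, List.get_eq_getElem, Fin.val_cast, List.getElem_map]
  constructor
  · intro h; rw [h]
  · intro h; exact hf _ (List.getElem_mem _) _ (List.getElem_mem _) h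

theorem M_of_map {f : α → β} {u : List α} (h : M C (u.map f))
    (hf : ∀ x ∈ u, ∀ y ∈ u, f x = f y → x = y) : M C u := by
  refine Q_intro h [] u rfl (by simp) ?_
  intro x y
  rcases x with i | i
  · exact i.elim0
  rcases y with j | j
  · exact j.elim0
  show (u.map f).get i = (u.map f).get j ↔ _
  simp only [Sum.elim_inr, List.get_eq_getElem, Fin.val_cast, List.getElem_map]
  constructor
  · intro h; exact hf _ (List.getElem_mem _) _ (List.getElem_mem _) h
  · intro h; rw [h]

theorem M_app {u : List α} {v : List β} (h : M C u) (h' : M C v) :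
    M C (u.map (Sum.inl : α → α ⊕ β) ++ v.map Sum.inr) := by
  refine Q_intro (C.tensor_mem h h') [] _ rfl (by simp) ?_
  intro x y
  rcases x with i | i
  · exact i.elim0
  rcases y with j | j
  · exact j.elim0
  refine Fin.addCases (fun i => ?_) (fun i => ?_) i <;>
  refine Fin.addCases (fun j => ?_) (fun j => ?_) j <;>
  (change Sum.LiftRel _ _ ((Equiv.sumSumSumComm (Fin 0) (Fin 0) (Fin u.length) (Fin v.length))
      (Sum.map finSumFinEquiv.symm finSumFinEquiv.symm (Sum.inr _)))
      ((Equiv.sumSumSumComm (Fin 0) (Fin 0) (Fin u.length) (Fin v.length))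
      (Sum.map finSumFinEquiv.symm finSumFinEquiv.symm (Sum.inr _))) ↔ _
   simp [Equiv.sumSumSumComm, List.getElem_append]
   try exact Iff.rfl)

theorem M_pair (a : α) : M C [a, a] := by
  have : Q C [a] [a] := by
    refine Q_intro C.id_mem [a] [a] rfl rfl ?_
    intro x y
    have hc : ∀ x : Fin 1 ⊕ Fin 1, Sum.elim (fun i : Fin 1 => [a].get i) (fun i : Fin 1 => [a].get i) x = a := by
      intro x; rcases x with i | i <;> simp
    refine iff_of_true trivial ((hc x).trans (hc y).symm)
  exact Q_right this

open Classical in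
/-- Replace `y` by `x`. -/
noncomputable def sub (x y : α) (z : α) : α := if z = y then x else z

theorem sub_left (x y : α) : sub x y x = x := by
  unfold sub
  split_ifs <;> rfl

theorem sub_right (x y : α) : sub x y y = x := by
  unfold sub
  simp

theorem Q_cap {U : List α} {x y : α} (h : Q C U [x, y]) : Q C (U.map (sub x y)) [] := by
  have hc : Q C [x, x] [] := Q_inv (M_pair x)
  refine Q_intro (C.comp_mem h hc) (U.map (sub x y)) [] (by simp) rfl ?_
  intro s t
  rcases s with i | i
  swap
  · exact i.elim0
  rcases t with j | j
  swap
  · exact j.elim0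
  show Relation.EqvGen _ (Sum.inl i) (Sum.inl j) ↔ _
  simp only [Sum.elim_inl, List.get_eq_getElem, Fin.val_cast, List.getElem_map]
  constructor
  · intro h
    let c : Fin U.length ⊕ (Fin 2 ⊕ Fin 0) → α :=
      Sum.elim (fun i => sub x y U[i]) (fun _ => x)
    suffices H : c (Sum.inl i) = c (Sum.inl j) from H
    have hy : ∀ a : Fin U.length ⊕ Fin 2, c (Sum.map id Sum.inl a) = sub x y (Sum.elim U.get [x,y].get a) := by
      intro a
      rcases a with a | a
      · rfl
      · fin_cases a
        · exact (sub_left x y).symm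
        · exact (sub_right x y).symm
    have hx : ∀ a : Fin 2 ⊕ Fin 0, c (Sum.inr a) = x := fun _ => rfl
    generalize (Sum.inl i : Fin U.length ⊕ (Fin 2 ⊕ Fin 0)) = s at h
    generalize (Sum.inl j : Fin U.length ⊕ (Fin 2 ⊕ Fin 0)) = t at h
    induction h with
    | rel s t h =>
      rcases h with ⟨a, b, hab, rfl, rfl⟩ | ⟨a, b, hab, rfl, rfl⟩
      · exact (hy a).trans ((congrArg _ hab).trans (hy b).symm)
      · exact (hx a).trans (hx b).symm
    | refl => rfl
    | symm _ _ _ ih => exact ih.symm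
    | trans _ _ _ _ _ ih1 ih2 => exact ih1.trans ih2
  · intro hs
    have r1 : ∀ a b : Fin U.length ⊕ Fin 2, Sum.elim U.get [x,y].get a = Sum.elim U.get [x,y].get b →
      Relation.EqvGen (fun x_1 y_1 : Fin U.length ⊕ (Fin 2 ⊕ Fin 0) =>
      (∃ a b, inSameBlock (Setoid.ker (Sum.elim U.get [x,y].get)) a b ∧ Sum.map id Sum.inl a = x_1 ∧ Sum.map id Sum.inl b = y_1) ∨
      (∃ a b, inSameBlock (Setoid.ker (Sum.elim [x,x].get ([] : List α).get)) a b ∧ Sum.inr a = x_1 ∧ Sum.inr b = y_1))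
      (Sum.map id Sum.inl a) (Sum.map id Sum.inl b) := fun a b hab =>
        Relation.EqvGen.rel _ _ (Or.inl ⟨a, b, hab, rfl, rfl⟩)
    have r2 : Relation.EqvGen (fun x_1 y_1 : Fin U.length ⊕ (Fin 2 ⊕ Fin 0) =>
      (∃ a b, inSameBlock (Setoid.ker (Sum.elim U.get [x,y].get)) a b ∧ Sum.map id Sum.inl a = x_1 ∧ Sum.map id Sum.inl b = y_1) ∨
      (∃ a b, inSameBlock (Setoid.ker (Sum.elim [x,x].get ([] : List α).get)) a b ∧ Sum.inr a = x_1 ∧ Sum.inr b = y_1))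
      (Sum.inr (Sum.inl 0)) (Sum.inr (Sum.inl 1)) :=
        Relation.EqvGen.rel _ _ (Or.inr ⟨Sum.inl 0, Sum.inl 1, rfl, rfl, rfl⟩)
    have key : ∀ i : Fin U.length, U[i] = y → _ := fun i hi =>
      Relation.EqvGen.trans _ _ _ (r1 (Sum.inl i) (Sum.inr 1) hi) (Relation.EqvGen.symm _ _ r2)
    have key' : ∀ i j : Fin U.length, U[i] = y → U[j] = x → _ := fun i j hi hj =>
      Relation.EqvGen.trans _ _ _ (key i hi) (r1 (Sum.inr 0) (Sum.inl j) hj.symm)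
    unfold sub at hs
    split_ifs at hs with h1 h2 h2
    · exact r1 (Sum.inl i) (Sum.inl j) (h1.trans h2.symm)
    · exact key' i j h1 hs.symm
    · exact Relation.EqvGen.symm _ _ (key' j i h2 hs)
    · exact r1 (Sum.inl i) (Sum.inl j) hs

theorem M_con {u v : List α} {x y : α} (h : M C (u ++ x :: y :: v)) :
    M C ((u ++ v).map (sub x y)) := by
  have h1 : M C ((v ++ u) ++ [x, y]) := by
    have := M_rot (u := u ++ [x, y]) (v := v) (by simpa using h)
    simpa using this
  have h2 := Q_cap (Q_ups h1)
  have h3 := Q_downs (V := ((v ++ u).reverse ++ []).map (sub x y)) (U := []) (by simpa using h2)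
  have h4 : M C (v.map (sub x y) ++ u.map (sub x y)) := by simpa [M] using h3
  simpa using M_rot h4

theorem sub_same (x : α) : sub x x = id := by
  funext z
  unfold sub
  split_ifs with h <;> simp [h]

theorem sub_ne {x y z : α} (h : z ≠ y) : sub x y z = z := by
  unfold sub
  simp [h]

theorem map_sub {x y : α} {l : List α} (h : y ∉ l) : l.map (sub x y) = l := by
  conv_rhs => rw [← List.map_id l]
  apply List.map_congr_left
  intro z hz
  exact sub_ne (fun e => h (e ▸ hz))

theorem M_con_same {u v : List α} {x : α} (h : M C (u ++ x :: x :: v)) : M C (u ++ v) := by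
  have := M_con h
  rw [sub_same] at this
  simpa using this

theorem M_pal {u v : List α} (P : List α) (h : M C (u ++ P ++ P.reverse ++ v)) : M C (u ++ v) := by
  induction P using List.reverseRecOn with
  | nil => simpa using h
  | append_singleton P z ih =>
    apply ih
    have : M C ((u ++ P) ++ z :: z :: (P.reverse ++ v)) := by simpa using h
    simpa using M_con_same this

theorem M_pal' {u v : List α} (P : List α) (h : M C (u ++ P.reverse ++ P ++ v)) : M C (u ++ v) :=
  M_pal P.reverse (by simpa using h)

theorem M_four (hH : Hyperoctahedral C) (a : α) : M C [a, a, a, a] := by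
  refine Q_intro hH.1 [] [a, a, a, a] rfl rfl ?_
  intro x y
  rcases x with i | i
  · exact i.elim0
  rcases y with j | j
  · exact j.elim0
  refine iff_of_true trivial ?_
  have : ∀ i : Fin 4, [a, a, a, a].get i = a := by
    intro i
    fin_cases i <;> rfl
  exact (this i).trans (this j).symm

theorem M_mrg (hH : Hyperoctahedral C) {u v : List α} {x y : α} (h : M C (u ++ x :: y :: v)) :
    M C ((u ++ x :: y :: v).map (sub x y)) := by
  have h1 : M C ((y :: v ++ u) ++ [x]) := by
    have := M_rot (u := u ++ [x]) (v := y :: v) (by simpa using h)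
    simpa using this
  have h2 := M_app h1 (M_four hH ())
  have h3 : M C ((y :: v ++ u).map Sum.inl ++ Sum.inl x :: Sum.inr () ::
      [Sum.inr (), Sum.inr (), (Sum.inr () : α ⊕ Unit)]) := by simpa using h2
  have h4 := M_con h3
  have h5 : M C ((y :: v ++ u ++ [x, x, x]).map (Sum.inl : α → α ⊕ Unit)) := by
    rw [List.map_append, map_sub] at h4
    · simpa [sub_right] using h4
    · simp
  have h6 := M_of_map h5 (by intro a _ b _ h; exact Sum.inl.inj h)
  have h7 : M C (v ++ u ++ [x, x] ++ x :: y :: []) := by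
    have := M_rot1 h6
    simpa using this
  have h8 := M_con h7
  have h9 : M C (v.map (sub x y) ++ (u ++ [x, y]).map (sub x y)) := by
    simpa [sub_left, sub_right] using h8
  simpa using M_rot h9

open Classical in
/-- Left copy if `S` holds, right copy otherwise. -/
noncomputable def tag (S : α → Prop) (x : α) : α ⊕ α := if S x then Sum.inl x else Sum.inr x

theorem tag_pos {S : α → Prop} {x : α} (h : S x) : tag S x = Sum.inl x := by simp [tag, h]

theorem tag_neg {S : α → Prop} {x : α} (h : ¬ S x) : tag S x = Sum.inr x := by simp [tag, h]

theorem tag_inj {S : α → Prop} {x y : α} (h : tag S x = tag S y) : x = y := by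
  unfold tag at h
  split_ifs at h <;> simpa using h

theorem M_refl_aux (v : List α) : ∀ (S : α → Prop) (u : List α),
    M C (u.map Sum.inl ++ v.map Sum.inl ++ (v.map (tag S)).reverse ++ (u.map (tag S)).reverse) →
    M C (u.map Sum.inl ++ (u.map (tag (fun x => S x ∨ x ∈ v))).reverse) := by
  induction v using List.reverseRecOn with
  | nil =>
    intro S u h
    simpa using h
  | append_singleton v z ih =>
    intro S u h
    have h1 : M C ((u.map Sum.inl ++ v.map Sum.inl) ++ Sum.inl z :: tag S z ::
      ((v.map (tag S)).reverse ++ (u.map (tag S)).reverse)) := by simpa using h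
    have h2 := M_con h1
    have e1 : (sub (Sum.inl z) (tag S z)) ∘ Sum.inl = (Sum.inl : α → α ⊕ α) := by
      funext t
      by_cases hz : S z
      · rw [tag_pos hz, sub_same]
        rfl
      · rw [tag_neg hz]
        exact sub_ne (by simp)
    have e2 : (sub (Sum.inl z) (tag S z)) ∘ (tag S) = tag (fun x => S x ∨ x = z) := by
      funext t
      by_cases ht : t = z
      · subst ht
        simp [sub_right, tag]
      · have : tag S t ≠ tag S z := fun e => ht (tag_inj e)
        show sub _ _ (tag S t) = _
        rw [sub_ne this]
        by_cases hS : S t <;> simp [tag, ht, hS]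
    simp only [List.map_append, ← List.map_reverse, List.map_map, e1, e2] at h2
    have h3 := ih (fun x => S x ∨ x = z) u (by simpa using h2)
    have e3 : (fun x => (S x ∨ x = z) ∨ x ∈ v) = (fun x => S x ∨ x ∈ v ++ [z]) := by
      funext x
      simp only [List.mem_append, List.mem_singleton, eq_iff_iff]
      tauto
    rw [e3] at h3
    exact h3

theorem M_refl {u v : List α} (h : M C (u ++ v)) :
    M C (u.map Sum.inl ++ (u.map (tag (fun x => x ∈ v))).reverse) := by
  have h1 := M_app h (M_rev h)
  have e : (Sum.inr : α → α ⊕ α) = tag (fun _ => False) := by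
    funext x; simp [tag]
  have := M_refl_aux (C := C) v (fun _ => False) u (by
    rw [← e]
    simpa using h1)
  simpa using this

theorem not_ds (hH : Hyperoctahedral C) {a b : α} (hab : a ≠ b) (h : M C [a, b]) : False := by
  apply hH.2
  refine Q_elim [] [a, b] h rfl rfl ?_
  intro x y
  rcases x with i | i
  · exact i.elim0
  rcases y with j | j
  · exact j.elim0
  show Sum.inr i = Sum.inr j ↔ _
  fin_cases i <;> fin_cases j <;> simp [hab, hab.symm]

theorem not_pp (hG : ¬ GroupTheoretical C) {a b : α} (hab : a ≠ b) (h : M C [b, a, a, b, a, a]) :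
    False := by
  apply hG
  refine Q_elim [a, a, b] [b, a, a] (Q_up (Q_up (Q_up h))) rfl rfl ?_
  intro x y
  show Sum.elim (fun i : Fin 3 => decide (i.val < 2)) (fun j : Fin 3 => decide (1 ≤ j.val)) x =
    Sum.elim (fun i : Fin 3 => decide (i.val < 2)) (fun j : Fin 3 => decide (1 ≤ j.val)) y ↔ _
  rcases x with i | i <;> rcases y with j | j <;> fin_cases i <;> fin_cases j <;>
    simp [hab, hab.symm]

theorem no_single (hH : Hyperoctahedral C) {u v : List α} {x : α} (h : M C (u ++ x :: v))
    (hu : x ∉ u) (hv : x ∉ v) : False := by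
  have h1 : M C ([x] ++ (v ++ u)) := by simpa using M_rot h
  have h2 := M_refl h1
  have : ¬ (x ∈ v ++ u) := by simp [hu, hv]
  have h3 : M C [Sum.inl x, (Sum.inr x : α ⊕ α)] := by
    simpa [tag_neg this, hu, hv, tag] using h2
  exact not_ds hH (by simp) h3

theorem no_pal (hH : Hyperoctahedral C) (hG : ¬ GroupTheoretical C) {a : α} : ∀ (Y : List α),
    Y ≠ [] → (a :: Y).Nodup → M C (a :: Y ++ [a, a] ++ Y.reverse ++ [a]) → False
  | [], h, _, _ => h rfl
  | [b], _, hn, h => by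
    have hab : a ≠ b := by simp at hn; exact hn
    have h1 : M C [b, a, a, b, a, a] := M_rot1 (by simpa using h)
    exact not_pp hG hab h1
  | [b, c], _, hn, h => by
    simp at hn
    have h1 : M C ([] ++ a :: b :: [c, a, a, c, b, a]) := by simpa using h
    have h2 := M_mrg hH h1
    have hcb : c ≠ b := fun e => hn.2 e.symm
    simp only [List.nil_append, List.map_cons, List.map_nil, sub_left, sub_right,
      sub_ne hcb] at h2
    have h3 : M C ([a, a, c, a, a, c] ++ a :: a :: []) := h2
    have h4 := M_con_same h3
    have h5 := M_rot (u := [a, a]) (v := [c, a, a, c]) h4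
    exact not_pp hG (fun e => hn.1.2 e) h5
  | b :: c :: d :: Y, _, hn, h => by
    have h1 : M C ([a] ++ b :: c :: (d :: Y ++ [a, a] ++ (d :: Y).reverse ++ [c, b, a])) := by
      simpa using h
    have h2 := M_mrg hH h1
    have hca : a ≠ c := by
      intro e; simp [e] at hn
    have hcd : c ∉ d :: Y := by
      simp only [List.nodup_cons] at hn
      exact hn.2.2.1
    have hcd' : c ∉ (d :: Y).reverse := by rw [List.mem_reverse]; exact hcd
    have hn' : (a :: d :: Y).Nodup := by
      simp only [List.nodup_cons] at hn ⊢
      refine ⟨?_, hn.2.2.2⟩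
      intro hm
      exact hn.1 (by simp at hm ⊢; tauto)
    simp only [List.map_append, map_sub hcd, map_sub hcd', List.map_cons, List.map_nil, sub_left,
      sub_right, sub_ne hca] at h2
    have h3 := M_con_same (u := [a]) h2
    have h4 : M C ((a :: (d :: Y) ++ [a, a] ++ (d :: Y).reverse) ++ b :: b :: [a]) := by
      simpa using h3
    have h5 := M_con_same h4
    exact no_pal hH hG (d :: Y) (by simp) hn' (by simpa using h5)

theorem exists_inner : ∀ (u : List α), u.IsChain (· ≠ ·) → ¬ u.Nodup →
    ∃ p a Y q, u = p ++ (a :: Y ++ [a]) ++ q ∧ (a :: Y).Nodup ∧ Y ≠ []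
  | [], _, h => absurd List.nodup_nil h
  | x :: t, hc, hn => by
    by_cases ht : t.Nodup
    · have hx : x ∈ t := by
        by_contra hx
        exact hn (List.nodup_cons.2 ⟨hx, ht⟩)
      obtain ⟨Y, q, rfl, hY⟩ := List.eq_append_cons_of_mem hx
      refine ⟨[], x, Y, q, by simp, List.nodup_cons.2 ⟨hY, ht.sublist (by simp)⟩, ?_⟩
      rintro rfl
      simp at hc
    · obtain ⟨p, a, Y, q, rfl, h1, h2⟩ := exists_inner t hc.tail ht
      exact ⟨x :: p, a, Y, q, by simp, h1, h2⟩

theorem M_nodup (hH : Hyperoctahedral C) (hG : ¬ GroupTheoretical C) {u v : List α}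
    (h : M C (u ++ v)) (hc : u.IsChain (· ≠ ·)) : u.Nodup := by
  by_contra hn
  obtain ⟨p, a, Y, q, rfl, h1, h2⟩ := exists_inner u hc hn
  have ha : M C ((a :: Y ++ [a]) ++ (q ++ v ++ p)) := by
    have := M_rot (u := p) (v := (a :: Y ++ [a]) ++ (q ++ v)) (by simpa using h)
    simpa using this
  set V := q ++ v ++ p with hV
  have hY : ∀ y ∈ Y, y ∈ V := by
    intro y hy
    by_contra hyV
    obtain ⟨s, t, rfl⟩ := List.append_of_mem hy
    have hb : M C ((a :: s) ++ y :: (t ++ a :: V)) := by simpa using ha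
    simp only [List.nodup_cons, List.nodup_append, List.mem_append, List.mem_cons] at h1
    refine no_single hH hb ?_ ?_
    · simp only [List.mem_cons, not_or]
      refine ⟨fun e => h1.1 (by simp [e]), fun e => h1.2.2.2 y e y (Or.inl rfl) rfl⟩
    · simp only [List.mem_cons, List.mem_append, not_or]
      refine ⟨h1.2.2.1.1, fun e => h1.1 (by simp [e]), hyV⟩
  have hr := M_refl ha
  have e1 : Y.map (tag (fun x => x ∈ V)) = Y.map Sum.inl :=
    List.map_congr_left (fun y hy => tag_pos (hY y hy))
  have hr2 : M C ((Sum.inl a :: Y.map Sum.inl) ++ Sum.inl a :: tag (fun x => x ∈ V) a ::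
      ((Y.map Sum.inl).reverse ++ [tag (fun x => x ∈ V) a])) := by
    simpa [e1] using hr
  have hr3 : M C ((a :: Y ++ [a, a] ++ Y.reverse ++ [a]).map (Sum.inl : α → α ⊕ α)) := by
    by_cases haV : a ∈ V
    · rw [tag_pos (S := fun x => x ∈ V) haV] at hr2
      simpa using hr2
    · rw [tag_neg (S := fun x => x ∈ V) haV] at hr2
      have hr4 := M_mrg hH hr2
      have n1 : (Sum.inr a : α ⊕ α) ∉ Y.map Sum.inl := by simp
      have n2 : (Sum.inr a : α ⊕ α) ∉ (Y.map Sum.inl).reverse := by simp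
      simp only [List.map_append, List.map_cons, List.map_nil, map_sub n1, map_sub n2, sub_left,
        sub_right] at hr4
      simpa using hr4
  exact no_pal hH hG Y h2 h1 (M_of_map hr3 (by intro a _ b _ h; exact Sum.inl.inj h))

theorem pi_step (hH : Hyperoctahedral C) : ∀ {L : List α} {n : ℕ}, L.length = n + 1 → L.Nodup →
    M C (L ++ L.reverse ++ L ++ L.reverse) →
    ∃ L' : List α, L'.length = n ∧ L'.Nodup ∧ M C (L' ++ L'.reverse ++ L' ++ L'.reverse)
  | [], n, hl, _, _ => by simp at hl
  | [x], n, hl, _, h => by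
    refine ⟨[], by simp at hl; simp [hl], List.nodup_nil, ?_⟩
    have h1 : M C ([x, x] ++ x :: x :: []) := by simpa using h
    have h2 : M C ([] ++ x :: x :: []) := by simpa using M_con_same h1
    simpa using M_con_same h2
  | x :: y :: L, n, hl, hn, h => by
    have hyL : y ∉ L := by simp at hn; exact hn.2.1
    have hyL' : y ∉ L.reverse := by simpa using hyL
    refine ⟨x :: L, by simpa using hl, hn.sublist (by simp), ?_⟩
    have h1 : M C ([] ++ x :: y :: (L ++ L.reverse ++ [y, x, x, y] ++ L ++ L.reverse ++ [y, x])) := by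
      simpa using h
    have h2 := M_mrg hH h1
    simp only [List.map_append, List.map_cons, List.map_nil, map_sub hyL, map_sub hyL', sub_left,
      sub_right, List.nil_append] at h2
    have h3 : M C ((x :: x :: (L ++ L.reverse ++ [x, x, x, x] ++ L ++ L.reverse)) ++ x :: x :: []) := by
      simpa using h2
    have h4 := M_con_same h3
    have h5 : M C ((x :: x :: (L ++ L.reverse)) ++ x :: x :: ([x, x] ++ L ++ L.reverse)) := by
      simpa using h4
    have h6 := M_con_same h5
    have h7 : M C ([x] ++ (x :: (L ++ L.reverse) ++ [x, x] ++ L ++ L.reverse)) := by simpa using h6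
    have h8 := M_rot h7
    simpa using h8

theorem pi_down (hH : Hyperoctahedral C) (k : ℕ) : ∀ (n : ℕ) {L : List α}, L.length = k + n →
    L.Nodup → M C (L ++ L.reverse ++ L ++ L.reverse) →
    ∃ L' : List α, L'.length = k ∧ L'.Nodup ∧ M C (L' ++ L'.reverse ++ L' ++ L'.reverse)
  | 0, L, hl, hn, h => ⟨L, hl, hn, h⟩
  | n + 1, L, hl, hn, h => by
    obtain ⟨L', h1, h2, h3⟩ := pi_step hH (n := k + n) hl hn h
    exact pi_down hH k n h1 h2 h3

theorem pi_final {L : List α} {k : ℕ} (hl : L.length = k) (hn : L.Nodup)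
    (h : M C (L ++ L.reverse ++ L ++ L.reverse)) :
    (⟨0, 4 * k, piPartition k⟩ : Σ k l : ℕ, Partition k l) ∈ C.mem := by
  refine Q_elim [] _ h rfl (by simp [hl]; ring) ?_
  have key0 : ∀ (i j : ℕ) (hj : j < L.length) (hi' : i < (L ++ L.reverse ++ L ++ L.reverse).length),
      (i = j ∨ i = 2 * k - 1 - j ∨ i = 2 * k + j ∨ i = 4 * k - 1 - j) →
      (L ++ L.reverse ++ L ++ L.reverse)[i] = L[j] := by
    intro i j hj hi' hij
    simp only [List.getElem_append, List.getElem_reverse, List.length_append, List.length_reverse]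
    split_ifs <;> first | omega | (congr 1; omega)
  have key : ∀ (i : ℕ) (hi : i < 4 * k) (hi' : i < (L ++ L.reverse ++ L ++ L.reverse).length),
      ∃ h : (if i % (2 * k) < k then i % (2 * k) else 2 * k - 1 - i % (2 * k)) < L.length,
      (L ++ L.reverse ++ L ++ L.reverse)[i] =
        L[if i % (2 * k) < k then i % (2 * k) else 2 * k - 1 - i % (2 * k)] := by
    intro i hi hi'
    have hmod : i % (2 * k) < 2 * k := Nat.mod_lt _ (by omega)
    refine ⟨by split_ifs <;> omega, ?_⟩
    have hm : i % (2 * k) = if i < 2 * k then i else i - 2 * k := by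
      split_ifs with h1
      · exact Nat.mod_eq_of_lt h1
      · rw [Nat.mod_eq_sub_mod (by omega), Nat.mod_eq_of_lt (by omega)]
    apply key0
    split_ifs at hm ⊢ <;> omega
  intro x y
  rcases x with i | i
  · exact i.elim0
  rcases y with j | j
  · exact j.elim0
  show (if i.val % (2 * k) < k then i.val % (2 * k) else 2 * k - 1 - i.val % (2 * k)) =
    (if j.val % (2 * k) < k then j.val % (2 * k) else 2 * k - 1 - j.val % (2 * k)) ↔ _
  simp only [Sum.elim_inr, List.get_eq_getElem, Fin.val_cast]
  obtain ⟨a1, a2⟩ := key i.val i.isLt (by simp [hl]; omega)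
  obtain ⟨b1, b2⟩ := key j.val j.isLt (by simp [hl]; omega)
  rw [a2, b2, hn.getElem_inj_iff]

theorem split_prefix (p : α → Prop) : ∀ (A : List α), ∃ P R, A = P ++ R ∧ (∀ x ∈ P, p x) ∧
    ∀ z ∈ R.head?, ¬ p z
  | [] => ⟨[], [], by simp⟩
  | a :: A => by
    by_cases ha : p a
    · obtain ⟨P, R, rfl, h1, h2⟩ := split_prefix p A
      exact ⟨a :: P, R, by simp, by simpa [ha] using h1, h2⟩
    · exact ⟨[], a :: A, by simp, by simp, by simpa using ha⟩

theorem chain_of_nodup {l : List α} (h : l.Nodup) : l.IsChain (· ≠ ·) := List.Pairwise.isChain h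

/-- Key disjointness: if the two copies of `R` meet at an untagged letter,
no letter of `R` is connected. -/
theorem not_tagged (hH : Hyperoctahedral C) (hG : ¬ GroupTheoretical C) {S : α → Prop} {R : List α}
    {V : List (α ⊕ α)} (hR : R.Nodup) (hhead : ∀ z ∈ R.head?, ¬ S z)
    (h : M C ((R.map (tag S)).reverse ++ R.map Sum.inl ++ V)) : ∀ x ∈ R, ¬ S x := by
  have n1 : (R.map (tag S)).Nodup := hR.map (fun _ _ e => tag_inj e)
  have n2 : (R.map (Sum.inl : α → α ⊕ α)).Nodup := hR.map Sum.inl_injective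
  have hc : ((R.map (tag S)).reverse ++ R.map Sum.inl).IsChain (· ≠ ·) := by
    rw [List.isChain_append]
    refine ⟨chain_of_nodup (List.nodup_reverse.2 n1), chain_of_nodup n2, ?_⟩
    intro x hx y hy
    rcases R with _ | ⟨z, R⟩
    · simp at hy
    · simp at hx hy hhead
      rw [← hx, ← hy, tag_neg hhead]
      simp
  have hn := M_nodup hH hG h hc
  intro x hx hS
  have := (List.nodup_append.1 hn).2.2 (Sum.inl x) (by
    rw [List.mem_reverse, List.mem_map]
    exact ⟨x, hx, tag_pos hS⟩) (Sum.inl x) (List.mem_map_of_mem hx)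
  exact this rfl

theorem stage2 (hH : Hyperoctahedral C) (hG : ¬ GroupTheoretical C) {P R as : List α}
    (hP : P.Nodup) (has : as.Nodup) (h1 : ∀ a ∈ as, a ∈ P) (h2 : ∀ a ∈ as, a ∈ R)
    (h : M C (P.reverse ++ P ++ R)) :
    (⟨0, 4 * as.length, piPartition as.length⟩ : Σ k l : ℕ, Partition k l) ∈ C.mem := by
  have hr := M_refl h
  obtain ⟨L', N', hPe, hL, hN⟩ := split_prefix (fun x => x ∈ R) P.reverse
  obtain ⟨L, rfl⟩ : ∃ L, L' = L.reverse := ⟨L'.reverse, by simp⟩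
  obtain ⟨N, rfl⟩ : ∃ N, N' = N.reverse := ⟨N'.reverse, by simp⟩
  have hPe' : P = N ++ L := by
    have := congrArg List.reverse hPe
    simpa using this
  subst hPe'
  set s := tag (fun x => x ∈ R) with hs
  have e1 : L.map s = L.map Sum.inl :=
    List.map_congr_left (fun y hy => tag_pos (hL y (by simpa using hy)))
  have hr2 : M C ((L.map Sum.inl).reverse ++ (N.map Sum.inl).reverse ++ N.map Sum.inl ++ L.map Sum.inl
      ++ (L.map Sum.inl).reverse ++ (N.map s).reverse ++ N.map s ++ L.map Sum.inl) := by
    simpa [e1] using hr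
  have hNn : N.reverse.Nodup := List.nodup_reverse.2 (hP.sublist (by simp))
  have hN0 : ∀ x ∈ N.reverse, ¬ x ∈ R := by
    have t1 : M C (((L.map Sum.inl).reverse ++ (N.map Sum.inl).reverse ++ N.map Sum.inl) ++ 
      ((N.map s).reverse ++ N.map s ++ L.map Sum.inl)) := by
      apply M_pal (L.map Sum.inl)
      simpa using hr2
    have t2 := M_rev t1
    have t3 := M_rot (u := (L.map Sum.inl).reverse) (v := (N.map s).reverse ++ N.map s ++ (N.map Sum.inl).reverse
      ++ N.map Sum.inl ++ L.map Sum.inl) (by simpa using t2)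
    have t4 := M_rot (u := (N.map s).reverse) (v := N.map s ++ (N.map Sum.inl).reverse
      ++ N.map Sum.inl ++ L.map Sum.inl ++ (L.map Sum.inl).reverse) (by simpa using t3)
    have t5 : M C (N.map s ++ (N.map Sum.inl).reverse ++ N.map Sum.inl ++ L.map Sum.inl ++ 
      (L.map Sum.inl).reverse ++ (N.map s).reverse) := by simpa using t4
    have t6 : M C (N.map s ++ (N.map Sum.inl).reverse ++ (N.map Sum.inl ++ L.map Sum.inl ++ 
      (L.map Sum.inl).reverse ++ (N.map s).reverse)) := by simpa using t5
    exact not_tagged hH hG (S := fun x => x ∈ R)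
      (V := N.map Sum.inl ++ L.map Sum.inl ++ (L.map Sum.inl).reverse ++ (N.map s).reverse) hNn hN
      (by simpa using t6)
  have hasL : as ⊆ L := by
    intro a ha
    rcases List.mem_append.1 (h1 a ha) with h | h
    · exact absurd (h2 a ha) (hN0 a (by simpa using h))
    · exact h
  have hlen := (List.subperm_of_subset has hasL).length_le
  have hfin : M C ((L ++ L.reverse ++ L ++ L.reverse).map (Sum.inl : α → α ⊕ α)) := by
    have t1 := M_pal' (u := (L.map Sum.inl).reverse) (v := L.map Sum.inl
      ++ (L.map Sum.inl).reverse ++ (N.map s).reverse ++ N.map s ++ L.map Sum.inl)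
      (N.map Sum.inl) (by simpa using hr2)
    have t2 := M_pal' (u := (L.map Sum.inl).reverse ++ L.map Sum.inl ++ (L.map Sum.inl).reverse)
      (v := L.map Sum.inl) (N.map s) (by simpa using t1)
    have t3 := M_rot (u := (L.map Sum.inl).reverse) (v := L.map Sum.inl ++ (L.map Sum.inl).reverse
      ++ L.map Sum.inl) (by simpa using t2)
    simpa using t3
  have hfin2 := M_of_map hfin (by intro a _ b _ h; exact Sum.inl.inj h)
  have hLn : L.Nodup := hP.sublist (by simp)
  obtain ⟨n, hn⟩ := Nat.exists_eq_add_of_le hlen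
  obtain ⟨K, k1, k2, k3⟩ := pi_down hH as.length n hn hLn hfin2
  exact pi_final k1 k2 k3

theorem stage1 (hH : Hyperoctahedral C) (hG : ¬ GroupTheoretical C) {A B V as : List α}
    (hA : A.Nodup) (has : as.Nodup) (h1 : ∀ a ∈ as, a ∈ A) (h2 : ∀ a ∈ as, a ∈ B)
    (h3 : ∀ a ∈ as, a ∈ V) (h : M C (A ++ B ++ V)) :
    (⟨0, 4 * as.length, piPartition as.length⟩ : Σ k l : ℕ, Partition k l) ∈ C.mem := by
  have hr := M_refl h
  obtain ⟨P, R, rfl, hP, hR⟩ := split_prefix (fun x => x ∈ V) A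
  set s := tag (fun x => x ∈ V) with hs
  have e1 : P.map s = P.map Sum.inl :=
    List.map_congr_left (fun y hy => tag_pos (hP y hy))
  have t1 : M C ((P.map Sum.inl ++ R.map Sum.inl ++ B.map Sum.inl ++ (B.map s).reverse) ++
      ((R.map s).reverse ++ (P.map Sum.inl).reverse)) := by
    simpa [e1] using hr
  have t2 := M_rot t1
  have t3 : M C ((R.map s).reverse ++ R.map Sum.inl ++ (B.map Sum.inl ++ (B.map s).reverse)) := by
    have := M_pal' (u := (R.map s).reverse) (v := R.map Sum.inl ++ (B.map Sum.inl ++ (B.map s).reverse))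
      (P.map Sum.inl) (by simpa using t2)
    simpa using this
  have hdis := not_tagged hH hG (hA.sublist (by simp)) hR t3
  have t4 := M_rot (u := (R.map s).reverse) (v := (P.map Sum.inl).reverse ++ P.map Sum.inl ++
    (R.map Sum.inl ++ B.map Sum.inl ++ (B.map s).reverse)) (by simpa using t2)
  have hPn : P.Nodup := hA.sublist (by simp)
  have := stage2 hH hG (P := P.map (Sum.inl : α → α ⊕ α)) (as := as.map Sum.inl)
    (R := R.map Sum.inl ++ B.map Sum.inl ++ (B.map s).reverse ++ (R.map s).reverse)
    (hPn.map Sum.inl_injective) (has.map Sum.inl_injective) ?_ ?_ (by simpa using t4)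
  · have e : (as.map (Sum.inl : α → α ⊕ α)).length = as.length := by simp
    rw [e] at this
    exact this
  · intro a ha
    obtain ⟨b, hb, rfl⟩ := List.mem_map.1 ha
    rcases List.mem_append.1 (h1 b hb) with h | h
    · exact List.mem_map_of_mem h
    · exact absurd (h3 b hb) (hdis b h)
  · intro a ha
    obtain ⟨b, hb, rfl⟩ := List.mem_map.1 ha
    have := h2 b hb
    simp [this]

theorem reduce_odd {as : List ℕ} : ∀ (n : ℕ) {A V : List ℕ}, A.length ≤ n → M C (A ++ V) →
    (∀ a ∈ as, Odd (A.count a)) →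
    ∃ A' : List ℕ, A'.IsChain (· ≠ ·) ∧ M C (A' ++ V) ∧ ∀ a ∈ as, Odd (A'.count a)
  | 0, A, V, hl, h, ho => by
    have : A = [] := List.length_eq_zero_iff.1 (by omega)
    subst this
    exact ⟨[], by simp, h, ho⟩
  | n + 1, A, V, hl, h, ho => by
    by_cases hc : A.IsChain (· ≠ ·)
    · exact ⟨A, hc, h, ho⟩
    · rw [List.isChain_iff_forall_rel_of_append_cons_cons] at hc
      push Not at hc
      obtain ⟨x, y, l1, l2, rfl, rfl⟩ := hc
      refine reduce_odd n (A := l1 ++ l2) (by simp at hl ⊢; omega) ?_ ?_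
      · have : M C (l1 ++ x :: x :: (l2 ++ V)) := by simpa using h
        simpa using M_con_same this
      · intro a ha
        have := ho a ha
        simp only [List.count_append, List.count_cons] at this ⊢
        split_ifs at this
        · rw [show l1.count a + (l2.count a + 1 + 1) = l1.count a + l2.count a + 2 by ring,
            Nat.odd_add] at this
          exact this.2 (by decide)
        · simpa using this

theorem statement14 (C : PartitionCategory) (hH : Hyperoctahedral C)
    (hG : ¬ GroupTheoretical C) (w : List ℕ)
    (hp : (⟨0, _, ofList w⟩ : Σ k l : ℕ, Partition k l) ∈ C.mem)
    (k : ℕ) (hk : wdepth w = k) :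
    (⟨0, 4 * k, piPartition k⟩ : Σ k l : ℕ, Partition k l) ∈ C.mem := by


  have hmem : k ∈ {k | ∃ r : ℕ, ContainsW (w.rotate r) k} := by
    rw [← hk]
    apply Nat.sSup_mem
    · exact ⟨0, 0, [], [], [], [], [], [], [], w, [], [], by simp [leg]⟩
    · refine ⟨w.length, ?_⟩
      rintro m ⟨r, as, Xa, Xb, Xc, Xd, Xka, Xkc, Y1, Y2, Y3, hl, hn, -, -, -, -, hw, ho⟩
      have hsub : as ⊆ w := by
        intro a ha
        have h1 : a ∈ leg as Xa := List.count_pos_iff.1 (ho a ha).1.pos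
        have : a ∈ w.rotate r := by
          rw [hw]; simp [h1]
        simpa using this
      rw [← hl]
      exact (List.subperm_of_subset hn hsub).length_le
  obtain ⟨r, as, Xa, Xb, Xc, Xd, Xka, Xkc, Y1, Y2, Y3, hl, hn, -, -, -, -, hw, ho⟩ := hmem
  have hM : M C w := by
    refine Q_intro hp [] w rfl rfl ?_
    intro x y
    rcases x with i | i
    · exact i.elim0
    rcases y with j | j
    · exact j.elim0
    exact Iff.rfl
  have hM2 : M C (w.rotate r) := by
    rw [List.rotate_eq_drop_append_take_mod]
    apply M_rot
    rw [List.take_append_drop]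
    exact hM
  rw [hw] at hM2
  have hM3 := M_rot (u := Y1) (v := leg as Xa ++ (Xka ++ leg as.reverse Xb ++ (Y2 ++
        leg as Xc ++ Xkc ++ leg as.reverse Xd ++ Y3))) (by simpa using hM2)
  have hM4 : M C (leg as Xa ++ ((Xka ++ leg as.reverse Xb) ++ (Y2 ++
        leg as Xc ++ Xkc ++ leg as.reverse Xd ++ Y3 ++ Y1))) := by simpa using hM3
  obtain ⟨A, hA1, hA2, hA3⟩ := reduce_odd (as := as) _ le_rfl hM4 (fun a ha => (ho a ha).1)
  have hAn := M_nodup hH hG hA2 hA1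
  subst hl
  refine stage1 hH hG hAn hn (fun a ha => List.count_pos_iff.1 (hA3 a ha).pos) (B := Xka ++ leg as.reverse Xb)
    (V := Y2 ++ leg as Xc ++ Xkc ++ leg as.reverse Xd ++ Y3 ++ Y1) ?_ ?_ (by simpa using hA2)
  · intro a ha
    have h1 : a ∈ leg as.reverse Xb := List.count_pos_iff.1 (ho a ha).2.1.pos
    simp [h1]
  · intro a ha
    have h1 : a ∈ leg as Xc := List.count_pos_iff.1 (ho a ha).2.2.1.pos
    simp [h1]

end EasyQG
end

section
/- Let C be a non group-theoretical hyperoctahedral category of partitions and let k ≥ 1. If p ∈ C ∩ P(0,2n) is a partition in single-double leg form with wdepth(p) ≤ k, then p ∈ ⟨π_l, l ≤ k⟩. -/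
namespace EasyQG

/-- Set of words closed under the word versions of the category operations. -/
structure WordClosed (L : Set (List ℕ)) : Prop where
  nil : [] ∈ L
  pair : ∀ a, [a, a] ∈ L
  rename : ∀ (w : List ℕ) (f : ℕ → ℕ), w ∈ L → (∀ x ∈ w, ∀ y ∈ w, f x = f y → x = y) →
    w.map f ∈ L
  rot : ∀ a w, a :: w ∈ L → w ++ [a] ∈ L
  tensor : ∀ w v, w ∈ L → v ∈ L → (∀ x ∈ w, x ∉ v) → w ++ v ∈ L
  cap : ∀ x y w, x :: y :: w ∈ L → w.map (fun z => if z = y then x else z) ∈ L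
  rev : ∀ w, w ∈ L → w.reverse ∈ L

/-- The words of a category. -/
def wordsOf (C : PartitionCategory) : Set (List ℕ) :=
  {w | (⟨0, _, ofList w⟩ : Σ k l : ℕ, Partition k l) ∈ C.mem}


/-- Two-row words. -/
def ofWords (u v : List ℕ) : Partition u.length v.length :=
  Setoid.ker (Sum.elim u.get v.get)

theorem ofWord_eq {n : ℕ} (f : Fin n → ℕ) (w : List ℕ) (h : n = w.length)
    (hf : ∀ i : Fin n, f i = w.get (i.cast h)) :
    (⟨0, n, ofWord f⟩ : Σ k l : ℕ, Partition k l) = ⟨0, w.length, ofList w⟩ := by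
  subst h
  have : f = w.get := by funext i; exact hf i
  subst this
  rfl

theorem ofList_eq_ofWords (w : List ℕ) : ofList w = ofWords [] w := by
  unfold ofList ofWord ofWords
  congr 1
  funext x
  rcases x with x | x
  · exact x.elim0
  · rfl

theorem comap_ker {α β γ : Type} (g : α → β) (f : β → γ) :
    Setoid.comap g (Setoid.ker f) = Setoid.ker (f ∘ g) := rfl

theorem rotUL_ofWords (a : ℕ) (u v : List ℕ) :
    rotUL (k := u.length) (l := v.length) (ofWords (a :: u) v) = ofWords u (a :: v) := by
  refine (comap_ker _ _).trans ?_
  unfold ofWords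
  congr 1
  funext x
  rcases x with x | x
  · rfl
  · refine Fin.cases ?_ (fun j => ?_) x <;> rfl

theorem rotLU_ofWords (a : ℕ) (u v : List ℕ) :
    rotLU (k := u.length) (l := v.length) (ofWords u (a :: v)) = ofWords (a :: u) v := by
  refine (comap_ker _ _).trans ?_
  unfold ofWords
  congr 1
  funext x
  rcases x with x | x
  · refine Fin.cases ?_ (fun j => ?_) x <;> rfl
  · rfl

theorem rotUR_ofWords (a : ℕ) (v : List ℕ) :
    rotUR (k := 0) (l := v.length) (ofWords [a] v) =
      ofWord (n := v.length + 1) (fun j => Fin.lastCases a v.get j) := by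
  refine (comap_ker _ _).trans ?_
  unfold ofWord
  congr 1
  funext x
  rcases x with x | x
  · exact x.elim0
  · refine Fin.lastCases ?_ (fun j => ?_) x
    · simp
    · simp

theorem wordsOf_rot (C : PartitionCategory) (a : ℕ) (w : List ℕ) (h : a :: w ∈ wordsOf C) :
    w ++ [a] ∈ wordsOf C := by
  have h1 : (⟨0, _, ofWords [] (a :: w)⟩ : Σ k l : ℕ, Partition k l) ∈ C.mem := by
    have := h
    unfold wordsOf at this
    rw [Set.mem_setOf_eq, ofList_eq_ofWords] at this
    exact this
  have h2 := C.rotLU_mem (k := 0) (l := w.length) h1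
  have e := rotLU_ofWords a [] w
  have h3 : (⟨1, w.length, ofWords [a] w⟩ : Σ k l : ℕ, Partition k l) ∈ C.mem := by
    rw [← e]; exact h2
  have h4 := C.rotUR_mem (k := 0) (l := w.length) h3
  rw [rotUR_ofWords] at h4
  rw [ofWord_eq _ (w ++ [a]) (by simp)] at h4
  · exact h4
  · intro i
    refine Fin.lastCases ?_ (fun j => ?_) i
    · simp
    · simp

theorem wordsOf_up (C : PartitionCategory) (u : List ℕ) : ∀ v : List ℕ,
    (⟨_, _, ofWords u v⟩ : Σ k l : ℕ, Partition k l) ∈ C.mem → u.reverse ++ v ∈ wordsOf C := by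
  induction u with
  | nil =>
    intro v h
    unfold wordsOf
    rw [Set.mem_setOf_eq, List.reverse_nil, List.nil_append, ofList_eq_ofWords]
    exact h
  | cons a u ih =>
    intro v h
    have h2 := C.rotUL_mem (k := u.length) (l := v.length) h
    rw [rotUL_ofWords] at h2
    simpa using ih (a :: v) h2

theorem involution_ofList (w : List ℕ) : involution (ofWords [] w) = ofWords w [] := by
  refine (comap_ker _ _).trans ?_
  unfold ofWords
  congr 1
  funext x
  rcases x with x | x
  · rfl
  · rfl

theorem wordsOf_rev (C : PartitionCategory) (w : List ℕ) (h : w ∈ wordsOf C) :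
    w.reverse ∈ wordsOf C := by
  unfold wordsOf at h
  rw [Set.mem_setOf_eq, ofList_eq_ofWords] at h
  have h2 := C.involution_mem h
  rw [involution_ofList] at h2
  simpa using wordsOf_up C w [] h2

theorem wordsOf_rename (C : PartitionCategory) (w : List ℕ) (f : ℕ → ℕ) (h : w ∈ wordsOf C)
    (hf : ∀ x ∈ w, ∀ y ∈ w, f x = f y → x = y) : w.map f ∈ wordsOf C := by
  have e : (⟨0, _, ofWord (f ∘ w.get)⟩ : Σ k l : ℕ, Partition k l) = ⟨0, _, ofList (w.map f)⟩ := by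
    apply ofWord_eq _ _ (by simp)
    intro i
    simp
  unfold wordsOf
  rw [Set.mem_setOf_eq, ← e]
  have : ofWord (f ∘ w.get) = ofList w := by
    unfold ofList ofWord
    ext x y
    rcases x with x | x
    · exact x.elim0
    rcases y with y | y
    · exact y.elim0
    simp only [Setoid.ker_def, Sum.elim_inr, Function.comp]
    constructor
    · exact hf _ (List.get_mem _ _) _ (List.get_mem _ _)
    · intro h; rw [h]
  rw [this]
  exact h

theorem wordsOf_tensor (C : PartitionCategory) (w v : List ℕ) (hw : w ∈ wordsOf C)
    (hv : v ∈ wordsOf C) (hd : ∀ x ∈ w, x ∉ v) : w ++ v ∈ wordsOf C := by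
  have h := C.tensor_mem hw hv
  have e : tensor (ofList w) (ofList v) = ofWord (n := w.length + v.length)
      (fun i => Sum.elim w.get v.get (finSumFinEquiv.symm i)) := by
    unfold tensor ofList ofWord
    ext x y
    rcases x with x | x
    · exact x.elim0
    rcases y with y | y
    · exact y.elim0
    simp only [Setoid.comap_rel, Setoid.ker_def, Sum.elim_inr, Sum.map_inr]
    generalize finSumFinEquiv.symm x = x'
    generalize finSumFinEquiv.symm y = y'
    rcases x' with x' | x' <;> rcases y' with y' | y'
    · simp only [Equiv.sumSumSumComm_apply]
      constructor
      · rintro (h | h); exact h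
      · intro h; exact Sum.LiftRel.inl h
    · constructor
      · rintro (h | h)
      · intro h
        exact (hd _ (List.get_mem w x') (by simp at h; rw [List.get_eq_getElem, h]; exact List.getElem_mem _)).elim
    · constructor
      · rintro (h | h)
      · intro h
        exact (hd _ (List.get_mem w y') (by simp at h; rw [List.get_eq_getElem, ← h]; exact List.getElem_mem _)).elim
    · constructor
      · rintro (h | h); exact h
      · intro h; exact Sum.LiftRel.inr h
  rw [e] at h
  have e2 := ofWord_eq (n := w.length + v.length)
      (fun i => Sum.elim w.get v.get (finSumFinEquiv.symm i)) (w ++ v) (by simp) (by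
    intro i
    refine Fin.addCases (fun j => ?_) (fun j => ?_) i
    · simp
    · simp)
  unfold wordsOf
  rw [Set.mem_setOf_eq, ← e2]
  exact h

theorem wordsOf_pair (C : PartitionCategory) (a : ℕ) : [a, a] ∈ wordsOf C := by
  have h := C.rotUL_mem (k := 0) (l := 1) C.id_mem
  have e : rotUL (k := 0) (l := 1) idPartition = ofList [a, a] := by
    unfold rotUL idPartition ofList ofWord
    ext x y
    rcases x with x | x
    · exact x.elim0
    rcases y with y | y
    · exact y.elim0
    simp only [Setoid.comap_rel, Setoid.ker_def]
    constructor
    · intro _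
      fin_cases x <;> fin_cases y <;> rfl
    · intro _; trivial
  unfold wordsOf
  rw [Set.mem_setOf_eq, ← e]
  exact h

theorem comp_pair (x y : ℕ) (w : List ℕ) :
    comp (k := 0) (l := 2) (m := w.length) (ofWords [] [0, 0]) (ofWords [y, x] w) =
      ofWord (fun i => (fun z => if z = y then x else z) (w.get i)) := by
  unfold comp ofWord
  ext s t
  rcases s with s | s
  · exact s.elim0
  rcases t with t | t
  · exact t.elim0
  simp only [Setoid.comap_rel, Setoid.ker_def, Sum.elim_inr, Sum.map_inr]
  constructor
  · intro h
    have key : ∀ a b, Relation.EqvGen (fun x_1 y_1 : Fin 0 ⊕ (Fin 2 ⊕ Fin w.length) =>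
        (∃ a b, inSameBlock (ofWords [] [0, 0]) a b ∧ Sum.map id Sum.inl a = x_1 ∧ Sum.map id Sum.inl b = y_1) ∨
        (∃ a b, inSameBlock (ofWords [y, x] w) a b ∧ Sum.inr a = x_1 ∧ Sum.inr b = y_1)) a b →
        Sum.elim (fun _ => 0) (fun c => (fun z => if z = y then x else z)
          (Sum.elim [y, x].get w.get c)) a =
        Sum.elim (fun _ => 0) (fun c => (fun z => if z = y then x else z)
          (Sum.elim [y, x].get w.get c)) b := by
      intro a b h
      induction h with
      | rel a b h =>
        rcases h with ⟨c, d, h, rfl, rfl⟩ | ⟨c, d, h, rfl, rfl⟩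
        · rcases c with c | c
          · exact c.elim0
          rcases d with d | d
          · exact d.elim0
          simp only [Sum.map_inr, Sum.elim_inr, Sum.elim_inl]
          have hc : ∀ c : Fin 2, (if [y, x].get c = y then x else [y, x].get c) = x := by
            intro c; fin_cases c <;> simp
          exact (hc c).trans (hc d).symm
        · simp only [Sum.elim_inr]
          have : Sum.elim [y, x].get w.get c = Sum.elim [y, x].get w.get d := h
          rw [this]
      | refl => rfl
      | symm _ _ _ ih => exact ih.symm
      | trans _ _ _ _ _ ih1 ih2 => exact ih1.trans ih2
    exact key _ _ h
  · intro h
    have q : ∀ a b, Sum.elim [y, x].get w.get a = Sum.elim [y, x].get w.get b →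
      Relation.EqvGen (fun x_1 y_1 : Fin 0 ⊕ (Fin 2 ⊕ Fin w.length) =>
        (∃ a b, inSameBlock (ofWords [] [0, 0]) a b ∧ Sum.map id Sum.inl a = x_1 ∧ Sum.map id Sum.inl b = y_1) ∨
        (∃ a b, inSameBlock (ofWords [y, x] w) a b ∧ Sum.inr a = x_1 ∧ Sum.inr b = y_1))
        (Sum.inr a) (Sum.inr b) := by
      intro a b h
      exact Relation.EqvGen.rel _ _ (Or.inr ⟨a, b, h, rfl, rfl⟩)
    have r : Relation.EqvGen (fun x_1 y_1 : Fin 0 ⊕ (Fin 2 ⊕ Fin w.length) =>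
        (∃ a b, inSameBlock (ofWords [] [0, 0]) a b ∧ Sum.map id Sum.inl a = x_1 ∧ Sum.map id Sum.inl b = y_1) ∨
        (∃ a b, inSameBlock (ofWords [y, x] w) a b ∧ Sum.inr a = x_1 ∧ Sum.inr b = y_1))
        (Sum.inr (Sum.inl (0 : Fin 2))) (Sum.inr (Sum.inl (1 : Fin 2))) := by
      refine Relation.EqvGen.rel _ _ (Or.inl ⟨Sum.inr (0 : Fin 2), Sum.inr (1 : Fin 2), ?_, rfl, rfl⟩)
      exact (rfl : (0 : ℕ) = 0)
    have key : ∀ s : Fin w.length, ∃ c : Fin 2 ⊕ Fin w.length,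
        Sum.elim [y, x].get w.get c = (if w.get s = y then x else w.get s) ∧
        Relation.EqvGen (fun x_1 y_1 : Fin 0 ⊕ (Fin 2 ⊕ Fin w.length) =>
        (∃ a b, inSameBlock (ofWords [] [0, 0]) a b ∧ Sum.map id Sum.inl a = x_1 ∧ Sum.map id Sum.inl b = y_1) ∨
        (∃ a b, inSameBlock (ofWords [y, x] w) a b ∧ Sum.inr a = x_1 ∧ Sum.inr b = y_1))
        (Sum.inr (Sum.inr s)) (Sum.inr c) := by
      intro s
      by_cases hs : w.get s = y
      · refine ⟨Sum.inl (1 : Fin 2), by simp only [if_pos hs]; rfl, ?_⟩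
        exact Relation.EqvGen.trans _ _ _ (q (Sum.inr s) (Sum.inl (0 : Fin 2)) hs) r
      · exact ⟨Sum.inr s, by simp only [if_neg hs]; rfl, Relation.EqvGen.refl _⟩
    obtain ⟨c, hc, hc'⟩ := key s
    obtain ⟨d, hd, hd'⟩ := key t
    have h' : Sum.elim [y, x].get w.get c = Sum.elim [y, x].get w.get d := by
      rw [hc, hd]; exact h
    exact Relation.EqvGen.trans _ _ _ hc' (Relation.EqvGen.trans _ _ _ (q _ _ h')
      (Relation.EqvGen.symm _ _ hd'))

theorem wordsOf_cap (C : PartitionCategory) (x y : ℕ) (w : List ℕ) (h : x :: y :: w ∈ wordsOf C) :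
    w.map (fun z => if z = y then x else z) ∈ wordsOf C := by
  have h1 : (⟨0, _, ofWords [] (x :: y :: w)⟩ : Σ k l : ℕ, Partition k l) ∈ C.mem := by
    have := h
    unfold wordsOf at this
    rw [Set.mem_setOf_eq, ofList_eq_ofWords] at this
    exact this
  have h2 := C.rotLU_mem (k := 0) (l := (y :: w).length) h1
  have e := rotLU_ofWords x [] (y :: w)
  have h3 : (⟨1, _, ofWords [x] (y :: w)⟩ : Σ k l : ℕ, Partition k l) ∈ C.mem := by
    rw [← e]; exact h2
  have h4 := C.rotLU_mem (k := 1) (l := w.length) h3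
  have e := rotLU_ofWords y [x] w
  have h5 : (⟨2, _, ofWords [y, x] w⟩ : Σ k l : ℕ, Partition k l) ∈ C.mem := by
    rw [← e]; exact h4
  have h6 : (⟨0, 2, ofWords [] [0, 0]⟩ : Σ k l : ℕ, Partition k l) ∈ C.mem := by
    have := wordsOf_pair C 0
    unfold wordsOf at this
    rw [Set.mem_setOf_eq, ofList_eq_ofWords] at this
    exact this
  have h7 := C.comp_mem h6 h5
  rw [comp_pair] at h7
  have e2 := ofWord_eq (fun i => (fun z => if z = y then x else z) (w.get i))
    (w.map (fun z => if z = y then x else z)) (by simp) (by intro i; simp)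
  unfold wordsOf
  rw [Set.mem_setOf_eq, ← e2]
  exact h7

theorem wordsOf_closed (C : PartitionCategory) : WordClosed (wordsOf C) where
  nil := by simpa using wordsOf_cap C 0 0 [] (wordsOf_pair C 0)
  pair := wordsOf_pair C
  rename := wordsOf_rename C
  rot := wordsOf_rot C
  tensor := wordsOf_tensor C
  cap := wordsOf_cap C
  rev := wordsOf_rev C

theorem wordsOf_four (C : PartitionCategory)
    (h : (⟨0, 4, fourBlock⟩ : Σ k l : ℕ, Partition k l) ∈ C.mem) (a : ℕ) :
    [a, a, a, a] ∈ wordsOf C := by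
  have e : fourBlock = ofList [a, a, a, a] := by
    unfold fourBlock ofList ofWord
    ext x y
    rcases x with x | x
    · exact x.elim0
    rcases y with y | y
    · exact y.elim0
    constructor
    · intro _
      fin_cases x <;> fin_cases y <;> rfl
    · intro _; trivial
  unfold wordsOf
  rw [Set.mem_setOf_eq, ← e]
  exact h

theorem wordsOf_singles (C : PartitionCategory) (a b : ℕ) (hab : a ≠ b)
    (h : [a, b] ∈ wordsOf C) :
    (⟨0, 2, doubleSingleton⟩ : Σ k l : ℕ, Partition k l) ∈ C.mem := by
  have e : doubleSingleton = ofList [a, b] := by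
    unfold doubleSingleton ofList ofWord
    ext x y
    rcases x with x | x
    · exact x.elim0
    rcases y with y | y
    · exact y.elim0
    rw [Setoid.bot_def, Setoid.ker_def]
    constructor
    · intro h; rw [h]
    · intro h
      fin_cases x <;> fin_cases y <;> first | rfl | exact (hab h).elim | exact (hab h.symm).elim
  rw [e]
  exact h

theorem wordsOf_positioner (C : PartitionCategory) (a b : ℕ) (hab : a ≠ b)
    (h : [b, a, a, b, a, a] ∈ wordsOf C) : GroupTheoretical C := by
  have h1 : (⟨0, _, ofWords [] [b, a, a, b, a, a]⟩ : Σ k l : ℕ, Partition k l) ∈ C.mem := by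
    have := h
    unfold wordsOf at this
    rw [Set.mem_setOf_eq, ofList_eq_ofWords] at this
    exact this
  have h2 := C.rotLU_mem (k := 0) (l := 5) h1
  have h2 : (⟨1, _, ofWords [b] [a, a, b, a, a]⟩ : Σ k l : ℕ, Partition k l) ∈ C.mem := by
    rw [← rotLU_ofWords]; exact h2
  have h2 := C.rotLU_mem (k := 1) (l := 4) h2
  have h2 : (⟨2, _, ofWords [a, b] [a, b, a, a]⟩ : Σ k l : ℕ, Partition k l) ∈ C.mem := by
    rw [← rotLU_ofWords]; exact h2
  have h2 := C.rotLU_mem (k := 2) (l := 3) h2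
  have h2 : (⟨3, 3, ofWords [a, a, b] [b, a, a]⟩ : Σ k l : ℕ, Partition k l) ∈ C.mem := by
    have e := rotLU_ofWords a [a, b] [b, a, a]
    rw [← e]; exact h2
  have e : pairPositioner = ofWords [a, a, b] [b, a, a] := by
    unfold pairPositioner ofWords
    ext x y
    rw [Setoid.ker_def, Setoid.ker_def]
    rcases x with x | x <;> rcases y with y | y <;> fin_cases x <;> fin_cases y <;>
      simp [hab, hab.symm]
  unfold GroupTheoretical
  rw [e]
  exact h2

end EasyQG

namespace EasyQG

theorem wordsOf_pi (C : PartitionCategory) (l : ℕ) (hl : 1 ≤ l)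
    (h : (⟨0, 4 * l, piPartition l⟩ : Σ k l : ℕ, Partition k l) ∈ C.mem)
    (T : List ℕ) (hT : T.Nodup) (hTl : T.length = l) :
    T ++ T.reverse ++ T ++ T.reverse ∈ wordsOf C := by
  have h1 : List.range l ++ (List.range l).reverse ++ List.range l ++ (List.range l).reverse
      ∈ wordsOf C := by
    unfold piPartition at h
    rw [ofWord_eq _ (List.range l ++ (List.range l).reverse ++ List.range l ++
      (List.range l).reverse) (by simp; omega)] at h
    · exact h
    · rintro ⟨i, hi⟩
      simp only [Fin.val_cast, List.get_eq_getElem, Fin.cast_mk]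
      rcases Nat.lt_or_ge i (2 * l) with h2 | h2
      · rw [Nat.mod_eq_of_lt h2]
        simp only [List.getElem_append, List.length_append, List.length_range, List.length_reverse,
          List.getElem_reverse, List.getElem_range]
        split_ifs <;> omega
      · have : i % (2 * l) = i - 2 * l := by
          rw [Nat.mod_eq_sub_mod h2, Nat.mod_eq_of_lt (by omega)]
        rw [this]
        simp only [List.getElem_append, List.length_append, List.length_range, List.length_reverse,
          List.getElem_reverse, List.getElem_range]
        split_ifs <;> omega
  have h2 := (wordsOf_closed C).rename _ (fun i => T.getD i 0) h1 (by
    intro x hx y hy hxy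
    have hx : x < T.length := by simpa [hTl] using hx
    have hy : y < T.length := by simpa [hTl] using hy
    simp only [List.getD_eq_getElem?_getD, List.getElem?_eq_getElem hx,
      List.getElem?_eq_getElem hy, Option.getD_some] at hxy
    exact (List.Nodup.getElem_inj_iff hT).1 hxy)
  have e : (List.range l).map (fun i => T.getD i 0) = T := by
    apply List.ext_getElem
    · simp [hTl]
    · intro i h1 h2
      simp [List.getElem?_eq_getElem h2]
  simpa only [List.map_append, List.map_reverse, e] using h2

namespace WordClosed
theorem rotApp {L : Set (List ℕ)} (hL : WordClosed L) (U V : List ℕ) : U ++ V ∈ L → V ++ U ∈ L := by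
  induction U generalizing V with
  | nil => simp
  | cons a U ih =>
    intro h
    have := hL.rot a (U ++ V) (by simpa using h)
    have := ih (V ++ [a]) (by simpa using this)
    simpa using this

theorem isRotated {L : Set (List ℕ)} (hL : WordClosed L) {w v : List ℕ} (h : w ~r v) (hw : w ∈ L) : v ∈ L := by
  obtain ⟨n, rfl⟩ := h
  rw [List.rotate_eq_drop_append_take_mod]
  apply hL.rotApp
  simpa using hw

/-- delete an adjacent equal pair -/
theorem del {L : Set (List ℕ)} (hL : WordClosed L) (U V : List ℕ) (a : ℕ) (h : U ++ a :: a :: V ∈ L) : U ++ V ∈ L := by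
  have h1 := hL.rotApp _ _ h
  have h2 := hL.cap a a (V ++ U) (by simpa using h1)
  apply hL.rotApp
  have : (fun z => if z = a then a else z) = (id : ℕ → ℕ) := by
    funext z; by_cases h : z = a <;> simp [h]
  rw [this] at h2
  simpa using h2

/-- cap at any place, keeping the label `x`. -/
theorem capAt {L : Set (List ℕ)} (hL : WordClosed L) (U V : List ℕ) (x y : ℕ) (h : U ++ x :: y :: V ∈ L) :
    (U ++ V).map (fun z => if z = y then x else z) ∈ L := by
  have h1 := hL.rotApp _ _ h
  have h2 := hL.cap x y (V ++ U) (by simpa using h1)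
  rw [List.map_append] at h2 ⊢
  exact hL.rotApp _ _ h2

theorem capAt' {L : Set (List ℕ)} (hL : WordClosed L) (U V : List ℕ) (x y : ℕ)
    (h : U ++ x :: y :: V ∈ L) :
    (U ++ V).map (fun z => if z = x then y else z) ∈ L := by
  have h1 := hL.rev _ h
  have h2 := hL.capAt V.reverse U.reverse y x (by simpa using h1)
  simpa using hL.rev _ h2

theorem replaceAux {L : Set (List ℕ)} (hL : WordClosed L) (U : List ℕ) :
    ∀ (f : ℕ → ℕ) (V Y : List ℕ),
    (∀ x ∈ V ++ U, ∀ y ∈ V ++ U, f x = f y → x = y) →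
    (∀ x ∈ V ++ U, f x = x ∨ f x ∉ U ++ Y) →
    (∀ x ∈ V, x ∈ U ∨ f x = x) →
    V.map f ++ (U.map f).reverse ++ U ++ Y ∈ L → V ++ Y ∈ L := by
  induction U with
  | nil =>
    intro f V Y hinj hnew hV h
    have : V.map f = V := by
      rw [List.map_congr_left (g := id)]
      · simp
      · intro x hx
        rcases hV x hx with h | h
        · simp at h
        · exact h
    simpa [this] using h
  | cons u U ih =>
    intro f V Y hinj hnew hV h
    have h1 := hL.capAt' (V.map f ++ (U.map f).reverse) (U ++ Y) (f u) u (by simpa using h)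
    have key : ∀ x ∈ V ++ U, (if f x = f u then u else f x) = if x = u then u else f x := by
      intro x hx
      by_cases hxu : x = u
      · simp [hxu]
      · rw [if_neg hxu, if_neg]
        intro h
        exact hxu (hinj x (by simp at hx ⊢; tauto) u (by simp) h)
    have keyY : ∀ x ∈ U ++ Y, (if x = f u then u else x) = x := by
      intro x hx
      split_ifs with hxu
      · rcases hnew u (by simp) with h | h
        · rw [hxu, h]
        · exfalso; apply h; rw [← hxu]; simp at hx ⊢; tauto
      · rfl
    refine ih (fun x => if x = u then u else f x) V Y ?_ ?_ ?_ ?_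
    · intro x hx y hy hxy
      have hx' : x ∈ V ++ u :: U := by simp at hx ⊢; tauto
      have hy' : y ∈ V ++ u :: U := by simp at hy ⊢; tauto
      split_ifs at hxy with h1 h2 h2
      · rw [h1, h2]
      · rcases hnew y hy' with h | h
        · rw [h1, hxy, h]
        · exfalso; apply h; rw [← hxy]; simp
      · rcases hnew x hx' with h | h
        · rw [h2, ← hxy, h]
        · exfalso; apply h; rw [hxy]; simp
      · exact hinj x hx' y hy' hxy
    · intro x hx
      split_ifs with h1
      · exact Or.inl h1.symm
      · rcases hnew x (by simp at hx ⊢; tauto) with h | h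
        · exact Or.inl h
        · right; intro h'; apply h; simp at h' ⊢; tauto
    · intro x hx
      split_ifs with h1
      · exact Or.inr h1.symm
      · rcases hV x hx with h | h
        · left; simp at h; tauto
        · exact Or.inr h
    · have e : (V.map f ++ (U.map f).reverse ++ (U ++ Y)).map (fun z => if z = f u then u else z) =
          V.map (fun x => if x = u then u else f x) ++
          (U.map (fun x => if x = u then u else f x)).reverse ++ U ++ Y := by
        rw [List.map_append, List.map_append, List.map_reverse, List.map_map, List.map_map,
          List.append_assoc _ U Y]
        congr 1
        · congr 1
          · apply List.map_congr_left
            intro x hx; exact key x (by simp [hx])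
          · congr 1
            apply List.map_congr_left
            intro x hx; exact key x (by simp [hx])
        · conv_rhs => rw [← List.map_id (U ++ Y)]
          apply List.map_congr_left
          intro x hx
          exact keyY x hx
      rw [← e]
      exact h1

/-- fresh copy of a set of letters -/
theorem exists_bound (w : List ℕ) : ∃ N, ∀ x ∈ w, x < N :=
  ⟨w.sum + 1, fun x hx => Nat.lt_succ_of_le (List.single_le_sum (by simp) x hx)⟩

/-- Replace the subword `U` by `V` using a word of `L`. -/
theorem replace {L : Set (List ℕ)} (hL : WordClosed L) (U V X Y : List ℕ)
    (h1 : V ++ U.reverse ∈ L) (hV : ∀ x ∈ V, x ∈ U) (h2 : X ++ U ++ Y ∈ L) : X ++ V ++ Y ∈ L := by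
  obtain ⟨N, hN⟩ := exists_bound (U ++ Y ++ X)
  have h3 := hL.rename _ (fun x => x + N) h1 (by intro x _ y _ h; simpa using h)
  have h4 : U ++ (Y ++ X) ∈ L := by
    have := hL.rotApp X (U ++ Y) (by simpa using h2)
    simpa using this
  have h5 := hL.tensor _ _ h3 h4 (by
    intro x hx hx'
    have := hN x (by simp at hx' ⊢; tauto)
    simp only [List.mem_map] at hx
    obtain ⟨y, _, rfl⟩ := hx
    omega)
  have h6 := hL.replaceAux U (fun x => x + N) V (Y ++ X) (by intro x _ y _ h; simpa using h)
    (by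
      intro x _
      right
      intro hx'
      have := hN (x + N) (by simp at hx' ⊢; tauto)
      omega)
    (fun x hx => Or.inl (hV x hx)) (by simpa using h5)
  have := hL.rotApp (V ++ Y) X (by simpa using h6)
  simpa using this

/-- Insert a pair with a fresh letter. -/
theorem insertFresh {L : Set (List ℕ)} (hL : WordClosed L) (U V : List ℕ) (a : ℕ)
    (ha : a ∉ U ++ V) (h : U ++ V ∈ L) : U ++ a :: a :: V ∈ L := by
  have h1 := hL.rotApp _ _ h
  have h2 := hL.tensor _ _ (hL.pair a) h1 (by
    intro x hx; simp at hx; subst hx; simp at ha ⊢; tauto)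
  have := hL.rotApp ([a, a] ++ V) U (by simpa using h2)
  simpa using this

/-- Merge two adjacent letters. -/
theorem merge {L : Set (List ℕ)} (hL : WordClosed L) (h4 : ∀ a, [a, a, a, a] ∈ L) (U V : List ℕ)
    (x y : ℕ) (h : U ++ x :: y :: V ∈ L) :
    (U ++ x :: y :: V).map (fun z => if z = y then x else z) ∈ L := by
  by_cases hxy : x = y
  · subst hxy
    have : (fun z => if z = x then x else z) = (id : ℕ → ℕ) := by
      funext z; by_cases h : z = x <;> simp [h]
    rw [this]; simpa using h
  -- xxx y
  have h1 := hL.replace [x] [x, x, x] U (y :: V) (by simpa using h4 x) (by simp) (by simpa using h)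
  have h2 := hL.replace [y] [y, y, y] (U ++ [x, x, x]) V (by simpa using h4 y) (by simp)
    (by simpa using h1)
  have h3 := hL.capAt (U ++ [x, x]) ([y, y] ++ V) x y (by simpa using h2)
  have h4' := hL.del (U.map (fun z => if z = y then x else z))
    ([x, x] ++ V.map (fun z => if z = y then x else z)) x (by simpa [hxy] using h3)
  simpa [hxy] using h4'

end WordClosed
end EasyQG

namespace EasyQG

/-- Words that are closed walks on trees, in terms of parities. -/
def Good (w : List ℕ) : Prop :=
  (∀ a, Even (w.count a)) ∧ ∀ U V U' V' b, w = U ++ b :: V → w = U' ++ b :: V' → ∀ a, a ≠ b →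
    (Even (U.count a) ↔ Even (U'.count a))

theorem exists_inner_repeat : ∀ w : List ℕ, ¬ w.Nodup →
    ∃ A b Y B, w = A ++ b :: Y ++ b :: B ∧ (b :: Y).Nodup := by
  intro w
  induction w with
  | nil => simp
  | cons c w ih =>
    intro h
    by_cases hw : w.Nodup
    · have hc : c ∈ w := by
        by_contra hc; exact h (List.nodup_cons.2 ⟨hc, hw⟩)
      obtain ⟨Y, B, rfl⟩ := List.append_of_mem hc
      refine ⟨[], c, Y, B, by simp, ?_⟩
      rw [List.nodup_append] at hw
      rw [List.nodup_cons]
      refine ⟨fun hcY => hw.2.2 c hcY c (by simp) rfl, hw.1⟩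
    · obtain ⟨A, b, Y, B, rfl, hn⟩ := ih hw
      exact ⟨c :: A, b, Y, B, by simp, hn⟩

namespace WordClosed

theorem core2 {L : Set (List ℕ)} (hL : WordClosed L)
    (hP : ∀ a b : ℕ, a ≠ b → [b, a, a, b, a, a] ∉ L) (b : ℕ) :
    ∀ Y : List ℕ, Y ≠ [] → (b :: Y).Nodup → b :: Y ++ [b, b] ++ Y.reverse ++ [b] ∈ L → False := by
  intro Y
  induction Y with
  | nil => simp
  | cons y Y ih =>
    intro _ hn h
    cases Y with
    | nil =>
      refine hP b y (by simp at hn; tauto) ?_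
      have := hL.rotApp [b] [y, b, b, y, b] (by simpa using h)
      simpa using this
    | cons z Y =>
      refine ih (by simp) (by simp at hn ⊢; tauto) ?_
      have h1 := hL.capAt [] (z :: Y ++ [b, b] ++ Y.reverse ++ [z, y, b]) b y (by simpa using h)
      have e : ([] ++ (z :: Y ++ [b, b] ++ Y.reverse ++ [z, y, b])).map
          (fun x => if x = y then b else x) = z :: Y ++ [b, b] ++ Y.reverse ++ [z, b, b] := by
        have hY : Y.map (fun x => if x = y then b else x) = Y := by
          conv_rhs => rw [← List.map_id Y]
          apply List.map_congr_left
          intro x hx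
          have : x ≠ y := by rintro rfl; simp at hn; tauto
          simp [this]
        have hzy : z ≠ y := by rintro rfl; simp at hn
        have hby : b ≠ y := by rintro rfl; simp at hn
        simp [hY, hzy, hby]
      rw [e] at h1
      have := hL.rotApp (z :: Y ++ [b, b] ++ Y.reverse ++ [z, b]) [b] (by simpa using h1)
      simpa using this

theorem core {L : Set (List ℕ)} (hL : WordClosed L) (h4 : ∀ a, [a, a, a, a] ∈ L)
    (hP : ∀ a b : ℕ, a ≠ b → [b, a, a, b, a, a] ∉ L) (b : ℕ) (Y X : List ℕ) (hY : Y ≠ [])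
    (hn : (b :: Y).Nodup) (hX : ∀ y ∈ Y, y ∈ X) (h : b :: Y ++ b :: X ∈ L) : False := by
  have h1 := hL.replace [b] [b, b, b] (b :: Y) X (by simpa using h4 b) (by simp) (by simpa using h)
  have h2 : b :: Y ++ [b] ++ (b :: b :: X) ++ [] ∈ L := by simpa using h1
  have h3 := hL.rev _ h2
  have h3 := hL.rotApp (b :: b :: X).reverse (b :: Y ++ [b]).reverse (by simpa using h3)
  have h5 := hL.replace (b :: b :: X) (b :: Y ++ [b]).reverse (b :: Y ++ [b]) [] h3 (by
    intro x hx
    simp at hx ⊢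
    rcases hx with h | h | h
    · exact Or.inl h
    · exact Or.inr (hX x h)
    · exact Or.inl h) h2
  exact hL.core2 hP b Y hY hn (by simpa using h5)

theorem noSingle {L : Set (List ℕ)} (hL : WordClosed L)
    (hS : ∀ a b : ℕ, a ≠ b → [a, b] ∉ L) (c : ℕ) : ∀ (n : ℕ) (X : List ℕ), X.length = n →
    c ∉ X → c :: X ∈ L → False := by
  intro n
  induction n using Nat.strong_induction_on with
  | _ n ih =>
    intro X hn hc h
    match X, hn with
    | [], _ =>
      have h1 := hL.rename _ (fun x => x + 1) h (by simp)
      have h2 := hL.tensor _ _ h h1 (by simp)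
      exact hS c (c + 1) (by simp) (by simpa using h2)
    | [x], _ => exact hS c x (by simp at hc; exact hc) h
    | x :: y :: X, hn =>
      have hcx : c ≠ x := by simp at hc; tauto
      have hcy : c ≠ y := by simp at hc; tauto
      have hcX : c ∉ X := by simp at hc; tauto
      have h1 := hL.capAt [c] X x y (by simpa using h)
      simp [hcy] at h1
      refine ih X.length (by rw [← hn]; simp) _ (by simp) ?_ h1
      intro hm
      rw [List.mem_map] at hm
      obtain ⟨z, hz, hz'⟩ := hm
      split_ifs at hz' with hzy
      · exact hcx hz'.symm
      · rw [hz'] at hz; exact hcX hz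

theorem evenCounts {L : Set (List ℕ)} (hL : WordClosed L) (h4 : ∀ a, [a, a, a, a] ∈ L)
    (hS : ∀ a b : ℕ, a ≠ b → [a, b] ∉ L)
    (hP : ∀ a b : ℕ, a ≠ b → [b, a, a, b, a, a] ∉ L) (a : ℕ) : ∀ (n : ℕ) (w : List ℕ),
    w.length = n → w ∈ L → Even (w.count a) := by
  intro n
  induction n using Nat.strong_induction_on with
  | _ n ih =>
    intro w hn h
    by_cases hw : w.Nodup
    · cases w with
      | nil => simp
      | cons c X =>
        rw [List.nodup_cons] at hw
        exact (hL.noSingle hS c _ X rfl hw.1 h).elim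
    · obtain ⟨A, b, Y, B, rfl, hY⟩ := exists_inner_repeat w hw
      by_cases hY0 : Y = []
      · subst hY0
        have h1 := hL.del A B b (by simpa using h)
        have h2 := ih (A ++ B).length (by rw [← hn]; simp <;> omega) _ rfl h1
        have e : (A ++ [b] ++ b :: B).count a = (A ++ B).count a + 2 * [b].count a := by
          simp only [List.count_append, List.count_cons, List.count_nil]; ring
        rw [e]
        exact h2.add (even_two_mul _)
      · exfalso
        refine hL.core h4 hP b Y (B ++ A) hY0 hY ?_ (by
          have := hL.rotApp A (b :: Y ++ b :: B) (by simpa using h)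
          simpa using this)
        intro y hy
        by_contra hyX
        obtain ⟨Y1, Y2, rfl⟩ := List.append_of_mem hy
        refine hL.noSingle hS y _ (Y2 ++ b :: B ++ A ++ b :: Y1) rfl ?_ (by
          have := hL.rotApp (A ++ b :: Y1) (y :: Y2 ++ b :: B) (by simpa using h)
          simpa using this)
        rw [List.nodup_cons, List.nodup_append] at hY
        obtain ⟨hb, hY1, hY2, hd⟩ := hY
        rw [List.nodup_cons] at hY2
        simp at hb hyX hd
        have := hd y
        simp
        tauto

theorem oddGap {L : Set (List ℕ)} (hL : WordClosed L) (h4 : ∀ a, [a, a, a, a] ∈ L)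
    (hS : ∀ a b : ℕ, a ≠ b → [a, b] ∉ L)
    (hP : ∀ a b : ℕ, a ≠ b → [b, a, a, b, a, a] ∉ L) : ∀ (n : ℕ) (a b : ℕ) (Y X : List ℕ),
    Y.length = n → b ∉ Y → b :: Y ++ b :: X ∈ L → Even (Y.count a) := by
  intro n
  induction n using Nat.strong_induction_on with
  | _ n ih =>
    intro a b Y X hn hb h
    by_contra hodd
    by_cases hY : Y.Nodup
    · refine hL.core h4 hP b Y X ?_ (List.nodup_cons.2 ⟨hb, hY⟩) ?_ h
      · rintro rfl; simp at hodd
      · intro y hy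
        by_contra hyX
        have h1 := hL.evenCounts h4 hS hP y _ _ rfl h
        have hyb : b ≠ y := by rintro rfl; exact hb hy
        have : List.count y Y = 1 := List.count_eq_one_of_mem hY hy
        simp [List.count_append, hyb, this, List.count_eq_zero_of_not_mem hyX] at h1
    · obtain ⟨A, c, Z, B, rfl, hZ⟩ := exists_inner_repeat Y hY
      by_cases hZ0 : Z = []
      · subst hZ0
        have h1 := hL.del (b :: A) (B ++ b :: X) c (by simpa using h)
        have h2 := ih (A ++ B).length (by rw [← hn]; simp <;> omega) a b (A ++ B) X rfl
          (by simp at hb ⊢; tauto) (by simpa using h1)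
        apply hodd
        have e : (A ++ [c] ++ c :: B).count a = (A ++ B).count a + 2 * [c].count a := by
          simp only [List.count_append, List.count_cons, List.count_nil]; ring
        rw [e]
        exact h2.add (even_two_mul _)
      · obtain ⟨z, Z', rfl⟩ := List.exists_cons_of_ne_nil hZ0
        have h1 := hL.rotApp (b :: A) (c :: z :: Z' ++ c :: B ++ b :: X) (by simpa using h)
        rw [List.nodup_cons] at hZ
        have h2 := ih (z :: Z').length (by rw [← hn]; simp <;> omega) z c (z :: Z')
          (B ++ b :: X ++ b :: A) rfl hZ.1 (by simpa using h1)
        rw [List.count_eq_one_of_mem hZ.2 (by simp)] at h2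
        simp at h2

theorem evenGap {L : Set (List ℕ)} (hL : WordClosed L) (h4 : ∀ a, [a, a, a, a] ∈ L)
    (hS : ∀ a b : ℕ, a ≠ b → [a, b] ∉ L)
    (hP : ∀ a b : ℕ, a ≠ b → [b, a, a, b, a, a] ∉ L) (a b : ℕ) (hab : a ≠ b) :
    ∀ (n : ℕ) (U M V : List ℕ),
    M.length = n → U ++ b :: M ++ b :: V ∈ L → Even (M.count a) := by
  intro n
  induction n using Nat.strong_induction_on with
  | _ n ih =>
    intro U M V hn h
    by_cases hb : b ∈ M
    · obtain ⟨M1, M2, rfl⟩ := List.append_of_mem hb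
      have h1 := ih M1.length (by rw [← hn]; simp <;> omega) U M1 (M2 ++ b :: V) rfl (by simpa using h)
      have h2 := ih M2.length (by rw [← hn]; simp <;> omega) (U ++ b :: M1) M2 V rfl (by simpa using h)
      simp [List.count_append, hab.symm]
      exact h1.add h2
    · have := hL.rotApp U (b :: M ++ b :: V) (by simpa using h)
      exact hL.oddGap h4 hS hP _ a b M (V ++ U) rfl hb (by simpa using this)

theorem good {L : Set (List ℕ)} (hL : WordClosed L) (h4 : ∀ a, [a, a, a, a] ∈ L)
    (hS : ∀ a b : ℕ, a ≠ b → [a, b] ∉ L)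
    (hP : ∀ a b : ℕ, a ≠ b → [b, a, a, b, a, a] ∉ L) (w : List ℕ) (hw : w ∈ L) : Good w := by
  refine ⟨fun a => hL.evenCounts h4 hS hP a _ w rfl hw, ?_⟩
  have key : ∀ U V M V' b, w = U ++ b :: V → b :: V = M ++ b :: V' → ∀ a, a ≠ b →
    (Even (U.count a) ↔ Even ((U ++ M).count a)) := by
    intro U V M V' b h1 h2 a hab
    cases M with
    | nil => simp
    | cons c M =>
      simp at h2
      obtain ⟨rfl, rfl⟩ := h2
      have := hL.evenGap h4 hS hP a b hab _ U M V' rfl (by rw [h1] at hw; simpa using hw)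
      rw [List.count_append, List.count_cons_of_ne (Ne.symm hab), Nat.even_add]
      simp [this]
  intro U V U' V' b h1 h2 a hab
  have h3 := h1.symm.trans h2
  rw [List.append_eq_append_iff] at h3
  rcases h3 with ⟨M, rfl, h3⟩ | ⟨M, rfl, h3⟩
  · exact key U V M V' b h1 h3 a hab
  · exact (key U' V' M V b h2 h3 a hab).symm

end WordClosed
end EasyQG

namespace EasyQG

theorem Good.gap {w : List ℕ} (h : Good w) (U M V : List ℕ) (b : ℕ)
    (hw : w = U ++ b :: M ++ b :: V) (a : ℕ) (hab : a ≠ b) : Even (M.count a) := by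
  have := h.2 U (M ++ b :: V) (U ++ b :: M) V b (by simp [hw]) (by simp [hw]) a hab
  rw [List.count_append, List.count_cons_of_ne (Ne.symm hab), Nat.even_add] at this
  tauto

theorem good_of_gap {w : List ℕ} (h1 : ∀ a, Even (w.count a))
    (h : ∀ U M V b, w = U ++ b :: M ++ b :: V → ∀ a, a ≠ b → Even (M.count a)) : Good w := by
  refine ⟨h1, ?_⟩
  have key : ∀ U V M V' b, w = U ++ b :: V → b :: V = M ++ b :: V' → ∀ a, a ≠ b →
    (Even (U.count a) ↔ Even ((U ++ M).count a)) := by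
    intro U V M V' b h1 h2 a hab
    cases M with
    | nil => simp
    | cons c M =>
      simp at h2
      obtain ⟨rfl, rfl⟩ := h2
      have := h U M V' b (by rw [h1]; simp) a hab
      rw [List.count_append, List.count_cons_of_ne (Ne.symm hab), Nat.even_add]
      simp [this]
  intro U V U' V' b h1 h2 a hab
  have h3 := h1.symm.trans h2
  rw [List.append_eq_append_iff] at h3
  rcases h3 with ⟨M, rfl, h3⟩ | ⟨M, rfl, h3⟩
  · exact key U V M V' b h1 h3 a hab
  · exact (key U' V' M V b h2 h3 a hab).symm

theorem Good.rev {w : List ℕ} (h : Good w) : Good w.reverse := by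
  apply good_of_gap
  · intro a; rw [List.count_reverse]; exact h.1 a
  · intro U M V b hw a hab
    have := h.gap V.reverse M.reverse U.reverse b (by
      rw [← List.reverse_reverse w, hw]; simp) a hab
    rwa [List.count_reverse] at this

theorem Good.rot1 {w : List ℕ} {c : ℕ} (h : Good (c :: w)) : Good (w ++ [c]) := by
  apply good_of_gap
  · intro a
    have := h.1 a
    rw [List.count_append, add_comm, ← List.count_append]
    simpa using this
  · intro U M V b hw a hab
    rcases List.eq_nil_or_concat V with rfl | ⟨V', d, rfl⟩
    · have h1 : w = U ++ b :: M ∧ c = b := by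
        have : w ++ [c] = (U ++ b :: M) ++ [b] := by simpa using hw
        have := List.append_inj' this rfl
        simpa using this
      obtain ⟨rfl, rfl⟩ := h1
      have h2 := h.gap [] U M c (by simp) a hab
      have h3 := h.1 a
      simp [List.count_append, hab.symm] at h3
      rw [Nat.even_add] at h3
      tauto
    · have h1 : w = U ++ b :: M ++ b :: V' ∧ c = d := by
        have : w ++ [c] = (U ++ b :: M ++ b :: V') ++ [d] := by simpa using hw
        have := List.append_inj' this rfl
        simpa using this
      obtain ⟨rfl, rfl⟩ := h1
      exact h.gap (c :: U) M V' b (by simp) a hab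

theorem Good.rotApp {U : List ℕ} : ∀ {V : List ℕ}, Good (U ++ V) → Good (V ++ U) := by
  induction U with
  | nil => simp
  | cons a U ih =>
    intro V h
    have := Good.rot1 (w := U ++ V) (c := a) (by simpa using h)
    have := ih (V := V ++ [a]) (by simpa using this)
    simpa using this

theorem isRotated_split {w v : List ℕ} (h : w ~r v) : ∃ U V, w = U ++ V ∧ v = V ++ U := by
  obtain ⟨n, rfl⟩ := h
  exact ⟨w.take (n % w.length), w.drop (n % w.length), by simp,
    List.rotate_eq_drop_append_take_mod⟩

theorem isRotated_app (U V : List ℕ) : (U ++ V) ~r (V ++ U) := List.isRotated_append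

theorem Good.isRotated {w v : List ℕ} (hw : Good w) (h : w ~r v) : Good v := by
  obtain ⟨U, V, rfl, rfl⟩ := isRotated_split h
  exact hw.rotApp

theorem ins_occ (U V A B : List ℕ) (b c : ℕ) (h : U ++ V = A ++ b :: B) :
    ∃ A' B', U ++ c :: c :: V = A' ++ b :: B' ∧ ∀ a, (Even (A'.count a) ↔ Even (A.count a)) := by
  rw [List.append_eq_append_iff] at h
  rcases h with ⟨M, rfl, h⟩ | ⟨M, rfl, h⟩
  · refine ⟨U ++ c :: c :: M, B, by simp [h], ?_⟩
    intro a
    have : (U ++ c :: c :: M).count a = (U ++ M).count a + 2 * [c].count a := by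
      simp only [List.count_append, List.count_cons, List.count_nil]; ring
    rw [this, Nat.even_add]
    simp
  · cases M with
    | nil =>
      simp at h
      refine ⟨A ++ [c, c], B, by simp [← h], ?_⟩
      intro a
      have : (A ++ [c, c]).count a = A.count a + 2 * [c].count a := by
        simp only [List.count_append, List.count_cons, List.count_nil]; ring
      rw [this, Nat.even_add]
      simp
    | cons d M =>
      simp at h
      obtain ⟨rfl, rfl⟩ := h
      exact ⟨A, M ++ c :: c :: V, by simp, fun a => Iff.rfl⟩

theorem Good.del {U V : List ℕ} {c : ℕ} (h : Good (U ++ c :: c :: V)) : Good (U ++ V) := by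
  refine ⟨?_, ?_⟩
  · intro a
    have h1 := h.1 a
    have : (U ++ c :: c :: V).count a = (U ++ V).count a + 2 * [c].count a := by
      simp only [List.count_append, List.count_cons, List.count_nil]; ring
    rw [this, Nat.even_add] at h1
    simpa using h1
  · intro A B A' B' b h1 h2 a hab
    obtain ⟨A1, B1, e1, p1⟩ := ins_occ U V A B b c h1
    obtain ⟨A2, B2, e2, p2⟩ := ins_occ U V A' B' b c h2
    rw [← p1 a, ← p2 a]
    exact h.2 A1 B1 A2 B2 b e1 e2 a hab

/-- `as` is (the edge sequence of) a path in the tree of `w`. -/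
def Ord (w as : List ℕ) : Prop :=
  ∀ A x B, as = A ++ x :: B → ∃ U V, w = U ++ x :: V ∧ (∀ y ∈ A, Odd (U.count y)) ∧
    (∀ y ∈ B, Even (U.count y))

/-- The configuration that yields a W of depth `k + 1`. -/
def Conf (k : ℕ) (w : List ℕ) : Prop :=
  ∃ P Q a xs r, (P ++ Q) ~r w ∧ xs.length + 1 = k ∧ (a :: xs ++ [r]).Nodup ∧ Even (P.count a) ∧
    r ∈ P ∧ r ∈ Q ∧ Ord (P ++ Q) (a :: xs ++ [r])

theorem Conf.isRotated {k : ℕ} {w v : List ℕ} (hw : Conf k w) (h : w ~r v) : Conf k v := by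
  obtain ⟨P, Q, a, xs, r, h1, h2⟩ := hw
  exact ⟨P, Q, a, xs, r, h1.trans h, h2⟩

theorem Conf.rev {k : ℕ} {w : List ℕ} (hg : Good w) (h : Conf k w) : Conf k w.reverse := by
  obtain ⟨P, Q, a, xs, r, h1, h2, h3, h4, h5, h6, h7⟩ := h
  have hg' := hg.isRotated h1.symm
  refine ⟨Q.reverse, P.reverse, a, xs, r, ?_, h2, h3, ?_, by simpa using h6, by simpa using h5, ?_⟩
  · rw [← List.reverse_append]; exact h1.reverse
  · have := hg'.1 a
    rw [List.count_append, Nat.even_add] at this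
    rw [List.count_reverse]; tauto
  · intro A x B e
    obtain ⟨U, V, e1, p1, p2⟩ := h7 A x B e
    rw [e] at h3
    have hx : ∀ y, y ≠ x → (Even (U.count y) ↔ Even (V.count y)) := by
      intro y hy
      have := hg'.1 y
      rw [e1, List.count_append, List.count_cons_of_ne hy.symm, Nat.even_add] at this
      exact this
    refine ⟨V.reverse, U.reverse, by rw [← List.reverse_append, e1]; simp, ?_, ?_⟩
    · intro y hy
      rw [List.count_reverse, ← Nat.not_even_iff_odd, ← hx y, Nat.not_even_iff_odd]
      · exact p1 y hy
      · rintro rfl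
        rw [List.nodup_append] at h3
        exact h3.2.2 y hy y (by simp) rfl
    · intro y hy
      rw [List.count_reverse, ← hx y]
      · exact p2 y hy
      · rintro rfl
        rw [List.nodup_append, List.nodup_cons] at h3
        exact h3.2.1.1 hy

theorem ins_rot {X U V : List ℕ} (c : ℕ) (h : X ~r (U ++ V)) :
    ∃ X1 X2, X = X1 ++ X2 ∧ (X1 ++ c :: c :: X2) ~r (U ++ c :: c :: V) := by
  obtain ⟨A, B, rfl, e⟩ := isRotated_split h
  rw [List.append_eq_append_iff] at e
  rcases e with ⟨M, rfl, rfl⟩ | ⟨M, rfl, rfl⟩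
  · refine ⟨A ++ U, M, by simp, ?_⟩
    have := isRotated_app A (U ++ c :: c :: M)
    simpa using this
  · refine ⟨M, V ++ B, by simp, ?_⟩
    have := isRotated_app (M ++ c :: c :: V) B
    simpa using this

theorem Conf.ins {k : ℕ} {U V : List ℕ} (c : ℕ) (h : Conf k (U ++ V)) :
    Conf k (U ++ c :: c :: V) := by
  obtain ⟨P, Q, a, xs, r, h1, h2, h3, h4, h5, h6, h7⟩ := h
  obtain ⟨X1, X2, e, hr⟩ := ins_rot c h1
  have hord : Ord (X1 ++ c :: c :: X2) (a :: xs ++ [r]) := by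
    intro A x B e'
    obtain ⟨U', V', e1, p1, p2⟩ := h7 A x B e'
    obtain ⟨U2, V2, e2, p⟩ := ins_occ X1 X2 U' V' x c (by rw [← e, e1])
    refine ⟨U2, V2, e2, ?_, ?_⟩
    · intro y hy
      rw [← Nat.not_even_iff_odd, p y, Nat.not_even_iff_odd]
      exact p1 y hy
    · intro y hy
      rw [p y]; exact p2 y hy
  rw [List.append_eq_append_iff] at e
  rcases e with ⟨M, rfl, rfl⟩ | ⟨M, rfl, rfl⟩
  · refine ⟨P, M ++ c :: c :: X2, a, xs, r, by simpa using hr, h2, h3, h4, h5, ?_,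
      by simpa using hord⟩
    simp at h6 ⊢; tauto
  · refine ⟨X1 ++ c :: c :: M, Q, a, xs, r, by simpa using hr, h2, h3, ?_, ?_, h6,
      by simpa using hord⟩
    · have : (X1 ++ c :: c :: M).count a = (X1 ++ M).count a + 2 * [c].count a := by
        simp only [List.count_append, List.count_cons, List.count_nil]; ring
      rw [this]
      exact h4.add (even_two_mul _)
    · simp at h5 ⊢; tauto

/-- The reduced word in the free product of copies of `ℤ/2`. -/
def red : List ℕ → List ℕ
  | [] => []
  | a :: w => if (red w).head? = some a then (red w).tail else a :: red w

theorem red_cons_push {a : ℕ} {w : List ℕ} (h : (red w).head? ≠ some a) :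
    red (a :: w) = a :: red w := by simp [red, h]

theorem red_cons_pop {a : ℕ} {w ρ : List ℕ} (h : red w = a :: ρ) :
    red (a :: w) = ρ := by simp [red, h]

theorem red_cases (a : ℕ) (w : List ℕ) : (∃ ρ, red w = a :: ρ ∧ red (a :: w) = ρ) ∨
    ((red w).head? ≠ some a ∧ red (a :: w) = a :: red w) := by
  by_cases h : (red w).head? = some a
  · left
    obtain ⟨ρ, hρ⟩ : ∃ ρ, red w = a :: ρ := by
      cases hw : red w with
      | nil => simp [hw] at h
      | cons b ρ => simp [hw] at h; exact ⟨ρ, by rw [h]⟩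
    exact ⟨ρ, hρ, red_cons_pop hρ⟩
  · exact Or.inr ⟨h, red_cons_push h⟩

theorem red_count (c : ℕ) : ∀ w : List ℕ, (Even ((red w).count c) ↔ Even (w.count c)) := by
  intro w
  induction w with
  | nil => simp [red]
  | cons a w ih =>
    rcases red_cases a w with ⟨ρ, h1, h2⟩ | ⟨_, h2⟩
    · rw [h2]
      rw [h1] at ih
      by_cases hac : a = c
      · subst hac
        rw [List.count_cons_self, Nat.even_add_one] at ih
        rw [List.count_cons_self, Nat.even_add_one]
        tauto
      · rw [List.count_cons_of_ne hac] at ih ⊢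
        exact ih
    · rw [h2]
      by_cases hac : a = c
      · subst hac
        rw [List.count_cons_self, Nat.even_add_one, List.count_cons_self, Nat.even_add_one, ih]
      · rw [List.count_cons_of_ne hac, List.count_cons_of_ne hac, ih]

theorem red_suffix : ∀ (w ρ1 ρ2 : List ℕ) (p : ℕ), red w = ρ1 ++ p :: ρ2 →
    ∃ B E, w = B ++ p :: E ∧ red (p :: E) = p :: ρ2 := by
  intro w
  induction w with
  | nil => intro ρ1 ρ2 p h; simp [red] at h
  | cons a w ih =>
    intro ρ1 ρ2 p h
    rcases red_cases a w with ⟨ρ, h1, h2⟩ | ⟨_, h2⟩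
    · rw [h2] at h
      subst h
      obtain ⟨B, E, rfl, h3⟩ := ih (a :: ρ1) ρ2 p (by simpa using h1)
      exact ⟨a :: B, E, by simp, h3⟩
    · cases ρ1 with
      | nil =>
        have h' := h
        rw [h2] at h
        simp at h
        obtain ⟨rfl, _⟩ := h
        exact ⟨[], w, by simp, by simpa using h'⟩
      | cons b ρ1 =>
        rw [h2] at h
        simp at h
        obtain ⟨B, E, rfl, h3⟩ := ih ρ1 ρ2 p h.2
        exact ⟨a :: B, E, by simp, h3⟩

theorem red_nodup : ∀ (w A : List ℕ), Good (A ++ w) → (red w).Nodup := by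
  intro w
  induction w with
  | nil => simp [red]
  | cons p w ih =>
    intro A h
    have hn := ih (A ++ [p]) (by simpa using h)
    rcases red_cases p w with ⟨ρ, h1, h2⟩ | ⟨h1, h2⟩
    · rw [h2]
      rw [h1, List.nodup_cons] at hn
      exact hn.2
    · rw [h2, List.nodup_cons]
      refine ⟨?_, hn⟩
      intro hp
      obtain ⟨ρ1, ρ2, e⟩ := List.append_of_mem hp
      cases ρ1 with
      | nil => rw [e] at h1; simp at h1
      | cons q ρ1 =>
        obtain ⟨B, E, rfl, h3⟩ := red_suffix w (q :: ρ1) ρ2 p e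
        rw [e] at hn
        have hq : q ∉ ρ1 ∧ q ≠ p ∧ q ∉ ρ2 := by
          simp at hn; tauto
        have c1 : Odd ((B ++ p :: E).count q) := by
          rw [← Nat.not_even_iff_odd, ← red_count, e]
          simp [List.count_append, List.count_eq_zero_of_not_mem hq.1,
            List.count_eq_zero_of_not_mem hq.2.2, hq.2.1.symm]
        have c2 : Even ((p :: E).count q) := by
          rw [← red_count, h3]
          simp [List.count_eq_zero_of_not_mem hq.2.2, hq.2.1.symm]
        have c3 := h.gap A B E p (by simp) q hq.2.1
        rw [List.count_append] at c1
        rw [← Nat.not_even_iff_odd] at c1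
        exact c1 (c3.add c2)

theorem red_of_no_pair : ∀ w : List ℕ, (∀ U c V, w ≠ U ++ c :: c :: V) → red w = w := by
  intro w
  induction w with
  | nil => simp [red]
  | cons a w ih =>
    intro h
    have e := ih (fun U c V h' => h (a :: U) c V (by simp [h']))
    rw [red_cons_push, e]
    rw [e]
    cases w with
    | nil => simp
    | cons b w =>
      simp
      rintro rfl
      exact h [] b w (by simp)

theorem exists_pair {A F : List ℕ} (hg : Good (A ++ F)) (he : ∀ a, Even (F.count a)) (hF : F ≠ []) :
    ∃ U c V, F = U ++ c :: c :: V := by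
  by_contra hcon
  push Not at hcon
  have h1 := red_of_no_pair F hcon
  have hn := red_nodup F A hg
  obtain ⟨c, F', rfl⟩ := List.exists_cons_of_ne_nil hF
  have := he c
  rw [h1] at hn
  rw [List.count_eq_one_of_mem hn (by simp)] at this
  simp at this

theorem depth_conf {k : ℕ} (hk : 1 ≤ k) {a : ℕ} {P Q P1 P2 : List ℕ}
    (hg : Good (a :: a :: P ++ a :: Q)) (haP : a ∉ P) (hPQ : ∀ x ∈ P, x ∈ Q) (hP : P = P1 ++ P2)
    (hlen : k ≤ (red P2).length) : Conf k (a :: a :: P ++ a :: Q) := by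
  have hPe : ∀ y, y ≠ a → Even (P.count y) := fun y hy => hg.gap [a] P Q a (by simp) y hy
  have hn : (red P2).Nodup := by
    have : Good ((a :: Q ++ a :: a :: P1) ++ P2) := by
      have := Good.rotApp (U := a :: a :: P) (V := a :: Q) hg
      rw [hP] at this
      simpa using this
    exact red_nodup _ _ this
  have hmem : ∀ x ∈ red P2, x ∈ P2 := by
    intro x hx
    obtain ⟨ρ1, ρ2, e⟩ := List.append_of_mem hx
    obtain ⟨B, E, rfl, _⟩ := red_suffix _ _ _ _ e
    simp
  obtain ⟨ρ1, ρ, e, hρ⟩ : ∃ ρ1 ρ, red P2 = ρ1 ++ ρ ∧ ρ.length = k :=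
    ⟨(red P2).take ((red P2).length - k), (red P2).drop ((red P2).length - k), by simp, by
      simp; omega⟩
  cases ρ with
  | nil => simp at hρ; omega
  | cons r ρ =>
    have hrP : r ∈ P := by
      rw [hP]; simp [hmem r (by rw [e]; simp)]
    have haP2 : a ∉ red P2 := fun h => haP (by rw [hP]; simp [hmem a h])
    refine ⟨a :: P ++ [a], Q ++ [a], a, ρ.reverse, r, ?_, by simpa using hρ, ?_, ?_, by simp [hrP],
      by simp [hPQ r hrP], ?_⟩
    · have := isRotated_app (a :: P ++ a :: Q) [a]
      simpa using this
    · rw [e] at hn haP2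
      have h1 := (List.nodup_append.1 hn).2.1
      have h2 : a ∉ r :: ρ := fun h => haP2 (by simp at h ⊢; tauto)
      have : a :: ρ.reverse ++ [r] = a :: (r :: ρ).reverse := by simp
      rw [this, List.nodup_cons, List.nodup_reverse]
      exact ⟨by simp at h2 ⊢; tauto, h1⟩
    · simp [List.count_append, List.count_eq_zero_of_not_mem haP]
    · intro A x B hA
      cases A with
      | nil =>
        simp at hA
        obtain ⟨rfl, _⟩ := hA
        exact ⟨[], P ++ [a] ++ (Q ++ [a]), by simp, by simp, by simp⟩
      | cons a' A =>
        simp at hA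
        obtain ⟨rfl, hA⟩ := hA
        have hA' : r :: ρ = B.reverse ++ x :: A.reverse := by
          have := congrArg List.reverse hA
          simpa using this
        rw [hA', ← List.append_assoc] at e
        obtain ⟨B1, E, rfl, h3⟩ := red_suffix _ _ _ _ e
        rw [e] at hn haP2
        rw [List.nodup_append] at hn
        obtain ⟨hn1, hn2, hn3⟩ := hn
        have hpar : ∀ y, y ≠ a → (Even ((a :: P1 ++ B1).count y) ↔
            Even ((x :: A.reverse).count y)) := by
          intro y hy
          have h1 := hPe y hy
          rw [hP, ← List.append_assoc, List.count_append, Nat.even_add] at h1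
          rw [List.cons_append, List.count_cons_of_ne hy.symm, h1, ← red_count, h3]
        refine ⟨a :: P1 ++ B1, E ++ [a] ++ (Q ++ [a]), by simp [hP], ?_, ?_⟩
        · intro y hy
          rw [List.mem_cons] at hy
          rcases hy with rfl | hy
          · have : y ∉ P1 ∧ y ∉ B1 := by
              rw [hP] at haP; simp at haP; tauto
            simp [List.count_append, List.count_eq_zero_of_not_mem this.1,
              List.count_eq_zero_of_not_mem this.2]
          · have hya : y ≠ a := by
              rintro rfl; apply haP2; simp [hy]
            rw [← Nat.not_even_iff_odd, hpar y hya, List.count_eq_one_of_mem hn2 (by simp [hy])]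
            simp
        · intro y hy
          have hya : y ≠ a := by
            rintro rfl; apply haP2; simp [hy]
          rw [hpar y hya, List.count_eq_zero_of_not_mem]
          · simp
          · intro h
            exact hn3 y (by simp [hy]) y h rfl

end EasyQG

namespace EasyQG

theorem mem_of_mem_red {w : List ℕ} {p : ℕ} (h : p ∈ red w) : p ∈ w := by
  obtain ⟨ρ1, ρ2, e⟩ := List.append_of_mem h
  obtain ⟨B, E, e', _⟩ := red_suffix w ρ1 ρ2 p e
  simp [e']

theorem move_aux {L : Set (List ℕ)} (hL : WordClosed L) {k : ℕ}
    (hpi : ∀ T : List ℕ, T.Nodup → 1 ≤ T.length → T.length ≤ k →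
      T ++ T.reverse ++ T ++ T.reverse ∈ L) {a : ℕ} {P Q : List ℕ}
    (hg : Good (a :: a :: P ++ a :: Q)) (haP : a ∉ P)
    (hd : ∀ P1 P2, P = P1 ++ P2 → (red P2).length + 1 ≤ k)
    (h : P ++ a :: Q ∈ L) : ∀ P2 P1 : List ℕ, P = P1 ++ P2 →
      P1 ++ red P2 ++ [a, a] ++ (red P2).reverse ++ P2 ++ a :: Q ∈ L := by
  have hn : ∀ P1 P2, P = P1 ++ P2 → (red P2 ++ [a]).Nodup := by
    intro P1 P2 e
    have h1 : (red P2).Nodup := by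
      apply red_nodup P2 (a :: Q ++ a :: a :: P1)
      have := Good.rotApp (U := a :: a :: P) (V := a :: Q) hg
      rw [e] at this
      simpa using this
    have h2 : a ∉ red P2 := fun h => haP (by rw [e]; simp [mem_of_mem_red h])
    rw [List.nodup_append]
    refine ⟨h1, by simp, ?_⟩
    intro x hx y hy
    simp at hy
    subst hy
    rintro rfl
    exact h2 hx
  intro P2
  induction P2 with
  | nil =>
    intro P1 e
    have h1 := hpi [a] (by simp) (by simp) (by have := hd P1 [] e; simpa [red] using this)
    have h2 : P1 ++ [a] ++ Q ∈ L := by simpa [e] using h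
    have := hL.replace [a] [a, a, a] P1 Q (by simpa using h1) (by simp) h2
    simpa [red] using this
  | cons p P2 ih =>
    intro P1 e
    have h1 := ih (P1 ++ [p]) (by simp [e])
    rcases red_cases p P2 with ⟨ρ, e1, e2⟩ | ⟨_, e2⟩
    · rw [e2]
      rw [e1] at h1
      have h2 := hn (P1 ++ [p]) P2 (by simp [e])
      have h3 := hd (P1 ++ [p]) P2 (by simp [e])
      rw [e1] at h2 h3
      have h4 := hpi _ h2 (by simp) (by simpa using h3)
      have h5 := hL.rotApp [p] (ρ ++ [a, a] ++ ρ.reverse ++ [p, p] ++ ρ ++ [a, a] ++ ρ.reverse ++ [p])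
        (by simpa using h4)
      have := hL.replace ([p, p] ++ ρ ++ [a, a] ++ ρ.reverse ++ [p]) (ρ ++ [a, a] ++ ρ.reverse ++ [p])
        P1 (P2 ++ a :: Q) (by simpa using h5) (by intro x; simp; tauto) (by simpa using h1)
      simpa using this
    · rw [e2]
      have h2 := hn P1 (p :: P2) e
      have h3 := hd P1 (p :: P2) e
      rw [e2] at h2 h3
      have h4 := hpi _ h2 (by simp) (by simpa using h3)
      have := hL.replace ([p] ++ red P2 ++ [a, a] ++ (red P2).reverse)
        ([p] ++ red P2 ++ [a, a] ++ (red P2).reverse ++ [p, p])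
        P1 (P2 ++ a :: Q) (by simpa using h4) (by intro x; simp; tauto) (by simpa using h1)
      simpa using this

theorem move {L : Set (List ℕ)} (hL : WordClosed L) {k : ℕ}
    (hpi : ∀ T : List ℕ, T.Nodup → 1 ≤ T.length → T.length ≤ k →
      T ++ T.reverse ++ T ++ T.reverse ∈ L) {a : ℕ} {P Q : List ℕ}
    (hg : Good (a :: a :: P ++ a :: Q)) (haP : a ∉ P)
    (hd : ∀ P1 P2, P = P1 ++ P2 → (red P2).length + 1 ≤ k)
    (h : P ++ a :: Q ∈ L) : a :: a :: P ++ a :: Q ∈ L := by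
  have h1 := move_aux hL hpi hg haP hd h P [] rfl
  have hPe : ∀ y, Even (P.count y) := by
    intro y
    by_cases hy : y = a
    · subst hy; simp [List.count_eq_zero_of_not_mem haP]
    · exact hg.gap [a] P Q a (by simp) y hy
  have hr : red P = [] := by
    have hn : (red P).Nodup := by
      apply red_nodup P (a :: Q ++ a :: [a])
      have := Good.rotApp (U := a :: a :: P) (V := a :: Q) hg
      simpa using this
    cases e : red P with
    | nil => rfl
    | cons c ρ =>
      exfalso
      have h2 := (red_count c P).2 (hPe c)
      rw [e] at hn h2
      have : ρ.count c = 0 := List.count_eq_zero_of_not_mem (List.nodup_cons.1 hn).1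
      simp [this] at h2
  rw [hr] at h1
  simpa using h1

/-- Splitting at the first occurrence. -/
theorem first_occ {c : ℕ} : ∀ {w : List ℕ}, c ∈ w → ∃ U V, w = U ++ c :: V ∧ c ∉ U := by
  intro w h
  obtain ⟨U, V, h1, h2⟩ := List.eq_append_cons_of_mem h
  exact ⟨U, V, h1, h2⟩

theorem last_occ {c : ℕ} : ∀ {w : List ℕ}, c ∈ w → ∃ U V, w = U ++ c :: V ∧ c ∉ V := by
  intro w h
  obtain ⟨U, V, h1, h2⟩ := first_occ (c := c) (w := w.reverse) (by simpa using h)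
  refine ⟨V.reverse, U.reverse, ?_, by simpa using h2⟩
  rw [← List.reverse_reverse w, h1]; simp

end EasyQG

namespace EasyQG

theorem find_pair {a c : ℕ} {P Q : List ℕ} (hg : Good (a :: a :: P ++ a :: Q)) (haP : a ∉ P)
    (hcP : c ∈ P) (hcQ : c ∉ Q) : ∃ P1 b P2, P = P1 ++ b :: b :: P2 ∧ b ∉ Q := by
  have hca : c ≠ a := by rintro rfl; exact haP hcP
  have hPc : Even (P.count c) := hg.gap [a] P Q a (by simp) c hca
  obtain ⟨U, V, rfl, hU⟩ := first_occ hcP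
  have hcV : c ∈ V := by
    by_contra hcV
    simp [List.count_append, List.count_eq_zero_of_not_mem hU,
      List.count_eq_zero_of_not_mem hcV] at hPc
  obtain ⟨Z, W, rfl, hZ⟩ := first_occ hcV
  have hF : ∀ y, Even ((c :: Z ++ [c]).count y) := by
    intro y
    by_cases hy : y = c
    · subst hy
      simp [List.count_append, List.count_eq_zero_of_not_mem hZ]
    · have := hg.gap (a :: a :: U) Z (W ++ a :: Q) c (by simp) y hy
      simpa [List.count_append, List.count_cons, Ne.symm hy] using this
  have hg2 : Good ((W ++ a :: Q ++ a :: a :: U) ++ (c :: Z ++ [c])) := by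
    have := Good.rotApp (U := a :: a :: U ++ c :: Z ++ [c]) (V := W ++ a :: Q) (by simpa using hg)
    simpa using this
  obtain ⟨F1, b, F2, e⟩ := exists_pair hg2 hF (by simp)
  refine ⟨U ++ F1, b, F2 ++ W, ?_, ?_⟩
  · have : U ++ (c :: Z ++ [c]) ++ W = U ++ (F1 ++ b :: b :: F2) ++ W := by rw [e]
    simpa using this
  · intro hbQ
    have hbc : b ≠ c := by rintro rfl; exact hcQ hbQ
    have h1 : F1.count c = 1 := by
      cases F1 with
      | nil => simp at e; exact absurd e.1.symm hbc
      | cons f F1 =>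
        simp only [List.cons_append, List.cons.injEq] at e
        obtain ⟨rfl, e⟩ := e
        rcases List.eq_nil_or_concat F2 with rfl | ⟨F2', f, rfl⟩
        · have := congrArg List.getLast? e
          simp at this
          exact absurd this.symm hbc
        · have e' : Z ++ [c] = (F1 ++ b :: b :: F2') ++ [f] := by simpa using e
          have := (List.append_inj' e' rfl).1
          rw [this] at hZ
          have : c ∉ F1 := fun h => hZ (by simp [h])
          simp [List.count_eq_zero_of_not_mem this]
    obtain ⟨Q1, Q2, rfl⟩ := List.append_of_mem hbQ
    have h2 := hg.2 (a :: a :: U ++ F1) (b :: F2 ++ W ++ a :: (Q1 ++ b :: Q2))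
      (a :: a :: (U ++ c :: (Z ++ c :: W)) ++ a :: Q1) Q2 b
      (by
        have : a :: a :: U ++ (c :: Z ++ [c]) ++ W ++ a :: (Q1 ++ b :: Q2) =
          a :: a :: U ++ (F1 ++ b :: b :: F2) ++ W ++ a :: (Q1 ++ b :: Q2) := by rw [e]
        simpa using this) (by simp) c (Ne.symm hbc)
    have hcQ1 : c ∉ Q1 := fun h => hcQ (by simp [h])
    have e1 : (a :: a :: U ++ F1).count c = 1 := by
      rw [List.count_append, h1]
      simp [List.count_cons, Ne.symm hca, List.count_eq_zero_of_not_mem hU]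
    have e2 : (a :: a :: (U ++ c :: (Z ++ c :: W)) ++ a :: Q1).count c =
        (U ++ c :: (Z ++ c :: W)).count c := by
      rw [List.count_append]
      simp [List.count_cons, Ne.symm hca, List.count_eq_zero_of_not_mem hcQ1]
    rw [e1, e2] at h2
    exact absurd (h2.2 hPc) (by decide)

theorem main_ind {L : Set (List ℕ)} (hL : WordClosed L) {k : ℕ} (hk : 1 ≤ k)
    (hpi : ∀ T : List ℕ, T.Nodup → 1 ≤ T.length → T.length ≤ k →
      T ++ T.reverse ++ T ++ T.reverse ∈ L) :
    ∀ n (w : List ℕ), w.length = n → Good w → ¬ Conf k w → w ∈ L := by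
  intro n
  induction n using Nat.strong_induction_on with
  | _ n IH =>
  have hdel : ∀ U V b, (U ++ b :: b :: V).length = n → Good (U ++ b :: b :: V) →
      ¬ Conf k (U ++ b :: b :: V) → U ++ V ∈ L := by
    intro U V b h1 h2 h3
    apply IH (U ++ V).length (by simp at h1 ⊢; omega) _ rfl h2.del
    intro h; exact h3 (h.ins b)
  have inner : ∀ m a (P Q : List ℕ), P.length = m → a ∉ P → (a :: a :: P ++ a :: Q).length = n →
      Good (a :: a :: P ++ a :: Q) → ¬ Conf k (a :: a :: P ++ a :: Q) →
      a :: a :: P ++ a :: Q ∈ L := by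
    intro m
    induction m using Nat.strong_induction_on with
    | _ m IH2 =>
    intro a P Q hm haP hlen hg hC
    by_cases hPQ : ∀ x ∈ P, x ∈ Q
    · apply move hL hpi hg haP
      · intro P1 P2 e
        by_contra hcon
        exact hC (depth_conf hk hg haP hPQ e (by omega))
      · simpa using hdel [] (P ++ a :: Q) a (by simpa using hlen) (by simpa using hg)
          (by simpa using hC)
    · push Not at hPQ
      obtain ⟨c, hcP, hcQ⟩ := hPQ
      obtain ⟨P1, b, P2, rfl, hbQ⟩ := find_pair hg haP hcP hcQ
      have hba : b ≠ a := by rintro rfl; exact haP (by simp)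
      by_cases h2 : b ∈ P2
      · obtain ⟨P3, P4, rfl, hb3⟩ := first_occ h2
        have hr : (a :: a :: (P1 ++ b :: b :: (P3 ++ b :: P4)) ++ a :: Q) ~r
            (b :: b :: P3 ++ b :: (P4 ++ a :: Q ++ a :: a :: P1)) := by
          have := isRotated_app (a :: a :: P1) (b :: b :: P3 ++ b :: (P4 ++ a :: Q))
          simpa using this
        refine hL.isRotated hr.symm (IH2 P3.length ?_ b P3 _ rfl hb3 ?_ (hg.isRotated hr) ?_)
        · simp at hm; omega
        · rw [← hr.perm.length_eq]; exact hlen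
        · intro h; exact hC (h.isRotated hr.symm)
      · by_cases h1 : b ∈ P1
        · obtain ⟨P4, P3, rfl, hb3⟩ := last_occ h1
          have hr : (a :: a :: (P4 ++ b :: P3 ++ b :: b :: P2) ++ a :: Q).reverse ~r
            (b :: b :: P3.reverse ++ b :: (P4.reverse ++ a :: a :: Q.reverse ++ a :: P2.reverse)) := by
            have := isRotated_app (Q.reverse ++ a :: P2.reverse)
              (b :: b :: P3.reverse ++ b :: (P4.reverse ++ [a, a]))
            simpa using this
          have h3 := hL.isRotated hr.symm (IH2 P3.length ?_ b P3.reverse _ (by simp)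
            (by simpa using hb3) ?_ (hg.rev.isRotated hr) ?_)
          · have := hL.rev _ h3
            rwa [List.reverse_reverse] at this
          · simp at hm; omega
          · rw [← hr.perm.length_eq, List.length_reverse]; exact hlen
          · intro h
            have := Conf.rev hg.rev (h.isRotated hr.symm)
            rw [List.reverse_reverse] at this
            exact hC this
        · have := hL.insertFresh (a :: a :: P1) (P2 ++ a :: Q) b (by simp [h1, h2, hba, hbQ])
            (hdel (a :: a :: P1) (P2 ++ a :: Q) b (by simpa using hlen) (by simpa using hg)
              (by simpa using hC))
          simpa using this
  intro w hw hg hC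
  by_cases hn : w = []
  · subst hn; exact hL.nil
  obtain ⟨U, a, V, rfl⟩ := exists_pair (A := []) hg hg.1 hn
  have hr : (U ++ a :: a :: V) ~r (a :: a :: (V ++ U)) := by
    simpa using isRotated_app U (a :: a :: V)
  have hlen : (a :: a :: (V ++ U)).length = n := by rw [← hr.perm.length_eq]; exact hw
  have hg' := hg.isRotated hr
  have hC' : ¬ Conf k (a :: a :: (V ++ U)) := fun h => hC (h.isRotated hr.symm)
  apply hL.isRotated hr.symm
  by_cases ha : a ∈ V ++ U
  · obtain ⟨P, Q, e, haP⟩ := first_occ ha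
    rw [e] at hlen hg' hC' ⊢
    exact inner P.length a P Q rfl haP hlen hg' hC'
  · exact hL.insertFresh [] (V ++ U) a (by simpa using ha) (hdel [] (V ++ U) a hlen hg' hC')

end EasyQG

namespace EasyQG

theorem leg_of_sublist (r : ℕ) : ∀ (ys : List ℕ) (a : ℕ) (U : List ℕ), ys.Sublist U →
    ∃ Xs : List (List ℕ), Xs.length = ys.length + 1 ∧ leg (a :: ys ++ [r]) Xs = a :: U ++ [r] := by
  intro ys
  induction ys with
  | nil => intro a U _; exact ⟨[U], by simp, by simp [leg]⟩
  | cons y ys ih =>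
    intro a U h
    obtain ⟨Z, U', rfl, h1, h2⟩ : ∃ Z U', U = Z ++ U' ∧ y ∈ Z ∧ ys.Sublist U' := by
      obtain ⟨Z, U', h0, h1, h2⟩ := List.cons_sublist_iff.1 h
      exact ⟨Z, U', h0, h1, h2⟩
    obtain ⟨Z1, Z2, rfl⟩ := List.append_of_mem h1
    obtain ⟨Xs, hX, e⟩ := ih y (Z2 ++ U') (h2.trans (List.sublist_append_right _ _))
    refine ⟨Z1 :: Xs, by simp [hX], ?_⟩
    simp only [List.cons_append] at e ⊢
    simp [leg, e]

/-- Every occurrence has the prescribed parities. -/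
def OrdAll (H as : List ℕ) : Prop :=
  ∀ A x B U V, as = A ++ x :: B → H = U ++ x :: V →
    (∀ y ∈ A, Odd (U.count y)) ∧ (∀ y ∈ B, Even (U.count y))

theorem ordAll_of {w as : List ℕ} (hg : Good w) (hn : as.Nodup) (h : Ord w as) : OrdAll w as := by
  intro A x B U V e1 e2
  obtain ⟨U', V', e3, h1, h2⟩ := h A x B e1
  rw [e1] at hn
  have hx : x ∉ A ∧ x ∉ B := by
    simp [List.nodup_append] at hn
    refine ⟨fun h => ?_, by tauto⟩
    have := hn.2.2 x h
    tauto
  constructor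
  · intro y hy
    have hne : y ≠ x := by rintro rfl; exact hx.1 hy
    have := hg.2 U V U' V' x e2 e3 y hne
    have h1 := h1 y hy
    rw [← Nat.not_even_iff_odd] at h1 ⊢
    tauto
  · intro y hy
    have hne : y ≠ x := by rintro rfl; exact hx.2 hy
    have := hg.2 U V U' V' x e2 e3 y hne
    have h2 := h2 y hy
    tauto

theorem OrdAll.rev {H as : List ℕ} (hn : as.Nodup) (he : ∀ x ∈ as, Even (H.count x))
    (h : OrdAll H as) : OrdAll H.reverse as := by
  intro A x B U V e1 e2
  have e3 : H = V.reverse ++ x :: U.reverse := by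
    rw [← List.reverse_reverse H, e2]; simp
  obtain ⟨h1, h2⟩ := h A x B _ _ e1 e3
  rw [e1] at hn
  have hx : x ∉ A ∧ x ∉ B := by
    simp [List.nodup_append] at hn
    refine ⟨fun h => ?_, by tauto⟩
    have := hn.2.2 x h
    tauto
  have key : ∀ y ∈ as, y ≠ x → (Even (U.count y) ↔ Even (V.count y)) := by
    intro y hy hne
    have := he y hy
    rw [e3, List.count_append, List.count_cons_of_ne (Ne.symm hne), List.count_reverse,
      List.count_reverse, Nat.even_add] at this
    exact this.symm
  constructor
  · intro y hy
    have hne : y ≠ x := by rintro rfl; exact hx.1 hy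
    have := key y (by simp [e1, hy]) hne
    have h1 := h1 y hy
    rw [List.count_reverse] at h1
    rw [← Nat.not_even_iff_odd] at h1 ⊢
    tauto
  · intro y hy
    have hne : y ≠ x := by rintro rfl; exact hx.2 hy
    have := key y (by simp [e1, hy]) hne
    have h2 := h2 y hy
    rw [List.count_reverse] at h2
    tauto

theorem OrdAll.sub {H as : List ℕ} (h : OrdAll H as) : ∀ (A : List ℕ) x B U V,
    as = A ++ x :: B → H = U ++ x :: V → A.Sublist U := by
  intro A
  induction A using List.reverseRecOn with
  | nil => simp
  | append_singleton A y ih =>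
    intro x B U V e1 e2
    have h1 := (h _ x B U V e1 e2).1 y (by simp)
    have hy : y ∈ U := by
      by_contra hc
      simp [List.count_eq_zero_of_not_mem hc] at h1
    obtain ⟨U', V', rfl⟩ := List.append_of_mem hy
    have := ih y (x :: B) U' (V' ++ x :: V) (by simp [e1]) (by simp [e2])
    exact this.append (by simp)

theorem half1 {H xs U V : List ℕ} {a r : ℕ} (hn : (a :: xs ++ [r]).Nodup)
    (h : OrdAll H (a :: xs ++ [r])) (hH : H = U ++ r :: V) (hr : r ∉ U) :
    ∃ U1 U2, U = U1 ++ a :: U2 ∧ xs.Sublist U2 ∧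
      ∀ x ∈ a :: xs ++ [r], Odd ((a :: U2 ++ [r]).count x) := by
  have h1 := (h (a :: xs) r [] U V (by simp) hH).1
  have h2 := h.sub (a :: xs) r [] U V (by simp) hH
  have haU : a ∈ U := h2.subset (by simp)
  obtain ⟨U1, U2, rfl, ha⟩ := first_occ haU
  have hxs : xs.Sublist U2 := by
    clear h1 hH hr haU
    induction U1 with
    | nil => simpa using h2
    | cons u U1 ih =>
      refine ih ?_ ?_
      · simp at ha; tauto
      · rw [List.cons_append] at h2
        rcases List.sublist_cons_iff.1 h2 with h3 | ⟨t, h3, h4⟩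
        · exact h3
        · simp at h3; simp [h3.1] at ha
  refine ⟨U1, U2, rfl, hxs, ?_⟩
  have hU1 : ∀ x ∈ a :: xs, x ∉ U1 := by
    intro x hx hxU
    rcases List.mem_cons.1 hx with rfl | hx
    · exact ha hxU
    obtain ⟨W1, W2, rfl⟩ := List.append_of_mem hxU
    obtain ⟨x1, x2, rfl⟩ := List.append_of_mem hx
    have := (h (a :: x1) x (x2 ++ [r]) W1 (W2 ++ a :: U2 ++ r :: V) (by simp) (by simp [hH])).1 a (by simp)
    have hc : a ∉ W1 := fun h => ha (by simp [h])
    simp [List.count_eq_zero_of_not_mem hc] at this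
  intro x hx
  by_cases hxr : x = r
  · subst hxr
    have hc : x ∉ a :: U2 := fun h => hr (by simp at h ⊢; tauto)
    rw [List.count_append, List.count_eq_zero_of_not_mem hc]
    simp
  · have hx' : x ∈ a :: xs := by simp at hx ⊢; tauto
    have := h1 x hx'
    rw [List.count_append, List.count_eq_zero_of_not_mem (hU1 x hx')] at this
    rw [List.count_append]
    simpa [List.count_cons, Ne.symm hxr] using this

theorem half {H xs : List ℕ} {a r : ℕ} (hn : (a :: xs ++ [r]).Nodup)
    (h : OrdAll H (a :: xs ++ [r])) (he : ∀ x ∈ a :: xs ++ [r], Even (H.count x)) (hr : r ∈ H) :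
    ∃ (Y Z X : List ℕ) (Xa Xb : List (List ℕ)), Xa.length = xs.length + 1 ∧
      Xb.length = xs.length + 1 ∧
      H = Y ++ leg (a :: xs ++ [r]) Xa ++ X ++ leg (a :: xs ++ [r]).reverse Xb ++ Z ∧
      ∀ x ∈ a :: xs ++ [r], Odd ((leg (a :: xs ++ [r]) Xa).count x) ∧
        Odd ((leg (a :: xs ++ [r]).reverse Xb).count x) := by
  obtain ⟨U, V, e, hU⟩ := first_occ hr
  have hV : r ∈ V := by
    by_contra hc
    have := he r (by simp)
    rw [e] at this
    simp [List.count_append, List.count_eq_zero_of_not_mem hU,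
      List.count_eq_zero_of_not_mem hc] at this
  obtain ⟨M, N, rfl, hN⟩ := last_occ hV
  obtain ⟨U1, U2, rfl, s1, o1⟩ := half1 hn h e hU
  obtain ⟨N1, N2, e2, s2, o2⟩ := half1 (U := N.reverse) hn (h.rev hn he)
    (V := M.reverse ++ r :: (U1 ++ a :: U2).reverse)
    (by simp [e]) (by simpa using hN)
  have e3 : N = N2.reverse ++ a :: N1.reverse := by
    rw [← List.reverse_reverse N, e2]; simp
  obtain ⟨Xa, la, ea⟩ := leg_of_sublist r xs a U2 s1
  obtain ⟨Xb, lb, eb⟩ := leg_of_sublist a xs.reverse r N2.reverse s2.reverse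
  have er : (a :: xs ++ [r]).reverse = r :: xs.reverse ++ [a] := by simp
  refine ⟨U1, N1.reverse, M, Xa, Xb, la, by simpa using lb, ?_, ?_⟩
  · rw [er, ea, eb, e, e3]; simp
  · intro x hx
    rw [er, ea, eb]
    refine ⟨o1 x hx, ?_⟩
    have := o2 x hx
    rw [← List.count_reverse] at this
    simpa using this

theorem Conf.containsW {k : ℕ} {w : List ℕ} (hg : Good w) (h : Conf k w) :
    ∃ n, ContainsW (w.rotate n) (k + 1) := by
  obtain ⟨P, Q, a, xs, r, h1, h2, hn, haP, hrP, hrQ, ho⟩ := h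
  obtain ⟨n, en⟩ := h1.symm
  refine ⟨n, ?_⟩
  rw [en]
  have hg1 := hg.isRotated h1.symm
  have hall := ordAll_of hg1 hn ho
  have hP : OrdAll P (a :: xs ++ [r]) := by
    intro A x B U V e1 e2
    exact hall A x B U (V ++ Q) e1 (by simp [e2])
  have haQ : Odd 1 → a ∈ Q := by
    intro _
    obtain ⟨Q1, Q2, rfl⟩ := List.append_of_mem hrQ
    have := (hall (a :: xs) r [] (P ++ Q1) Q2 (by simp) (by simp)).1 a (by simp)
    by_contra hc
    have hc : a ∉ Q1 := fun h => hc (by simp [h])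
    rw [List.count_append, List.count_eq_zero_of_not_mem hc, add_zero,
      ← Nat.not_even_iff_odd] at this
    exact this haP
  have hPe : ∀ x ∈ a :: xs ++ [r], Even (P.count x) := by
    intro x hx
    rw [List.cons_append, List.mem_cons] at hx
    rcases hx with rfl | hx
    · exact haP
    obtain ⟨Q1, Q2, rfl, ha1⟩ := first_occ (haQ (by decide))
    have h3 := (hall [] a (xs ++ [r]) (P ++ Q1) Q2 (by simp) (by simp)).2 x hx
    have hxQ : x ∉ Q1 := by
      intro hxQ
      obtain ⟨W1, W2, rfl⟩ := List.append_of_mem hxQ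
      obtain ⟨x1, x2, ex⟩ := List.append_of_mem hx
      have := (hall (a :: x1) x x2 (P ++ W1) (W2 ++ a :: Q2) (by simp [ex]) (by simp)).1 a (by simp)
      have hc : a ∉ W1 := fun h => ha1 (by simp [h])
      rw [List.count_append, List.count_eq_zero_of_not_mem hc, add_zero,
        ← Nat.not_even_iff_odd] at this
      exact this haP
    rwa [List.count_append, List.count_eq_zero_of_not_mem hxQ] at h3
  have hQe : ∀ x ∈ a :: xs ++ [r], Even (Q.count x) := by
    intro x hx
    have := hg1.1 x
    rw [List.count_append, Nat.even_add] at this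
    exact this.1 (hPe x hx)
  have hQ : OrdAll Q (a :: xs ++ [r]) := by
    intro A x B U V e1 e2
    have := hall A x B (P ++ U) V e1 (by simp [e2])
    constructor
    · intro y hy
      have h3 := this.1 y hy
      rw [← Nat.not_even_iff_odd, List.count_append, Nat.even_add] at h3
      rw [← Nat.not_even_iff_odd]
      have := hPe y (by simp only [e1]; simp [hy])
      tauto
    · intro y hy
      have h3 := this.2 y hy
      rw [List.count_append, Nat.even_add] at h3
      have := hPe y (by simp only [e1]; simp [hy])
      tauto
  obtain ⟨Y, Z, X, Xa, Xb, la, lb, eP, oP⟩ := half hn hP hPe hrP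
  obtain ⟨Y', Z', X', Xc, Xd, lc, ld, eQ, oQ⟩ := half hn hQ hQe hrQ
  refine ⟨a :: xs ++ [r], Xa, Xb, Xc, Xd, X, X', Y, Z ++ Y', Z', by simp; omega, hn, by omega,
    by omega, by omega, by omega, ?_, ?_⟩
  · rw [eP, eQ]
    simp only [List.append_assoc]
  · intro x hx
    exact ⟨(oP x hx).1, (oP x hx).2, (oQ x hx).1, (oQ x hx).2⟩

theorem leg_length : ∀ (as : List ℕ) (Xs : List (List ℕ)), as.length ≤ (leg as Xs).length := by
  intro as
  induction as with
  | nil => simp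
  | cons a as ih =>
    intro Xs
    cases as with
    | nil => simp [leg]
    | cons b as =>
      have := ih Xs.tail
      simp only [leg, List.length_cons, List.length_append] at this ⊢
      omega

theorem le_wdepth {w : List ℕ} {k n : ℕ} (h : ContainsW (w.rotate n) k) : k ≤ wdepth w := by
  apply le_csSup
  · refine ⟨w.length, ?_⟩
    rintro m ⟨r, as, Xa, Xb, Xc, Xd, Xka, Xkc, Y1, Y2, Y3, h1, _, _, _, _, _, e, _⟩
    have h2 := congrArg List.length e
    have h3 := leg_length as Xa
    simp only [List.length_rotate, List.length_append] at h2
    omega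
  · exact ⟨n, h⟩

theorem statement15 (C : PartitionCategory) (hH : Hyperoctahedral C)
    (hG : ¬ GroupTheoretical C) (k : ℕ) (hk : 1 ≤ k)
    (w : List ℕ) (hlen : Even w.length) (hsd : IsSingleDoubleLegForm w)
    (hp : (⟨0, _, ofList w⟩ : Σ k l : ℕ, Partition k l) ∈ C.mem)
    (hdepth : wdepth w ≤ k) :
    (⟨0, _, ofList w⟩ : Σ k l : ℕ, Partition k l) ∈ generated (piUpTo k) := by
  have hg : Good w := WordClosed.good (wordsOf_closed C) (wordsOf_four C hH.1)
    (fun a b hab h => hH.2 (wordsOf_singles C a b hab h))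
    (fun a b hab h => hG (wordsOf_positioner C a b hab h)) w hp
  have hC : ¬ Conf k w := by
    intro h
    obtain ⟨n, hn⟩ := h.containsW hg
    have := le_wdepth hn
    omega
  intro D hD
  exact main_ind (wordsOf_closed D) hk (fun T h1 h2 h3 =>
    wordsOf_pi D T.length h2 (hD ⟨T.length, h2, h3, rfl⟩) T h1 rfl) w.length w rfl hg hC

end EasyQG
end
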